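/- Let a, b, c, d, e, f ∈ ℂ. Then z = 0 is not a center, with period ω = 2π, for the equation ż = z⁴ + (c·cos t + d·sin t + e·cos t·sin²t + f·sin t·cos²t)·z³ + (a·cos t + b·sin t)·z² (here the cubic coefficient is the general homogeneous polynomial of degree 3 in cos t and sin t, and the quadratic coefficient is homogeneous of degree 1). -/

import Mathlib

/-- `z` is a solution of `ż = F(t,z)` on `[0, ω]`. -/
def IsSolution (ω : ℝ) (F : ℝ → ℂ → ℂ) (z : ℝ → ℂ) : Prop :=
  ∀ t ∈ Set.Icc (0 : ℝ) ω, HasDerivAt z (F t (z t)) t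

/-- `z = 0` is a center for `ż = F(t,z)` with period `ω`. -/
def IsCenter (ω : ℝ) (F : ℝ → ℂ → ℂ) : Prop :=
  ∃ ε > (0 : ℝ), ∀ c : ℂ, ‖c‖ < ε →
    ∃ z : ℝ → ℂ, IsSolution ω F z ∧ z 0 = c ∧ z ω = c


set_option linter.unusedVariables false
set_option linter.unusedSimpArgs false

open Complex

/-- Laurent polynomial evaluation -/
noncomputable def evL (L : List (ℂ × ℕ × ℕ)) (X Y : ℂ) : ℂ :=
  (L.map fun c => c.1 * X ^ c.2.1 * Y ^ c.2.2).sum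

noncomputable def thL (L : List (ℂ × ℕ × ℕ)) (X Y : ℂ) : ℂ :=
  (L.map fun c => ((c.2.1 : ℂ) - (c.2.2 : ℂ)) * (c.1 * X ^ c.2.1 * Y ^ c.2.2)).sum

noncomputable def Xf (l : ℂ) (t : ℝ) : ℂ := l * exp (I * t)
noncomputable def Yf (l : ℂ) (t : ℝ) : ℂ := l⁻¹ * exp (-(I * t))

theorem XY_one {l : ℂ} (hl : l ≠ 0) (t : ℝ) : Xf l t * Yf l t = 1 := by
  unfold Xf Yf
  rw [exp_neg]
  have := exp_ne_zero (I * t)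
  field_simp

theorem Xf_deriv (l : ℂ) (t : ℝ) : HasDerivAt (Xf l) (I * Xf l t) t := by
  have h : HasDerivAt (fun t : ℝ => I * (t : ℂ)) I t := by
    simpa using (ofRealCLM.hasDerivAt (x := t)).const_mul I
  exact ((h.cexp).const_mul l).congr_deriv (by unfold Xf; ring)

theorem Yf_deriv (l : ℂ) (t : ℝ) : HasDerivAt (Yf l) (-(I * Yf l t)) t := by
  have h : HasDerivAt (fun t : ℝ => -(I * (t : ℂ))) (-I) t := by
    exact ((ofRealCLM.hasDerivAt (x := t)).const_mul I).fun_neg.congr_deriv (by simp)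
  exact ((h.cexp).const_mul l⁻¹).congr_deriv (by unfold Yf; ring)

theorem Xf_cont (l : ℂ) : Continuous (Xf l) := by unfold Xf; fun_prop
theorem Yf_cont (l : ℂ) : Continuous (Yf l) := by unfold Yf; fun_prop

theorem Xf_per (l : ℂ) : Xf l (2 * Real.pi) = Xf l 0 := by
  unfold Xf
  have : I * ((2 * Real.pi : ℝ) : ℂ) = 2 * Real.pi * I := by push_cast; ring
  rw [this, exp_two_pi_mul_I]; simp

theorem Yf_per (l : ℂ) : Yf l (2 * Real.pi) = Yf l 0 := by
  unfold Yf
  have : I * ((2 * Real.pi : ℝ) : ℂ) = 2 * Real.pi * I := by push_cast; ring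
  rw [this, exp_neg, exp_two_pi_mul_I]; simp

theorem evL_deriv (L : List (ℂ × ℕ × ℕ)) (l : ℂ) (t : ℝ) :
    HasDerivAt (fun t => evL L (Xf l t) (Yf l t)) (I * thL L (Xf l t) (Yf l t)) t := by
  induction L with
  | nil => simpa [evL, thL] using hasDerivAt_const t (0 : ℂ)
  | cons c L ih =>
    obtain ⟨c, m, n⟩ := c
    have h1 := (((Xf_deriv l t).pow m).const_mul c).mul ((Yf_deriv l t).pow n)
    have h2 := h1.add ih
    simp only [evL, thL, List.map_cons, List.sum_cons] at h2 ⊢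
    refine h2.congr_deriv ?_
    rw [mul_add]
    congr 1
    rcases m with _ | m <;> rcases n with _ | n <;> simp [pow_succ] <;> ring

theorem evL_cont (L : List (ℂ × ℕ × ℕ)) (l : ℂ) :
    Continuous (fun t => evL L (Xf l t) (Yf l t)) :=
  continuous_iff_continuousAt.2 fun t => (evL_deriv L l t).continuousAt

theorem thL_cont (L : List (ℂ × ℕ × ℕ)) (l : ℂ) :
    Continuous (fun t => thL L (Xf l t) (Yf l t)) := by
  have := Xf_cont l
  have := Yf_cont l
  induction L with
  | nil => simpa [thL] using continuous_const
  | cons c L ih =>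
    simp only [thL, List.map_cons, List.sum_cons] at ih ⊢
    exact Continuous.add (by fun_prop) ih

/-- family of closed solutions in the simplified coordinates -/
def Fam (l p q r s u v g : ℂ) : Prop :=
  ∃ K : ℝ, ∃ ε > (0 : ℝ), ∀ c : ℂ, 0 < ‖c‖ → ‖c‖ < ε → ∃ y : ℝ → ℂ,
    y (2 * Real.pi) = y 0 ∧ ∀ t ∈ Set.Icc (0 : ℝ) (2 * Real.pi),
      ‖y t - c‖ ≤ K * ‖c‖ ^ 2 ∧ 1 - (p * Xf l t - q * Yf l t) * y t ≠ 0 ∧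
      HasDerivAt y (I * ((r * Xf l t + s * Yf l t + u * Xf l t ^ 3 + v * Yf l t ^ 3) * y t ^ 3 /
          (1 - (p * Xf l t - q * Yf l t) * y t)
        + g * y t ^ 4 / (1 - (p * Xf l t - q * Yf l t) * y t) ^ 2)) t

theorem alg_id (h th : ℕ → ℂ) (A Q g y : ℂ) (h0 : h 0 = 0) (t0 : th 0 = 0) (t1 : th 1 = 0)
    (h2 : h 2 = 0) (t2 : th 2 = 0) (M : ℕ) :
    (1 - A * y) ^ 2 * ∑ k ∈ Finset.range (M + 4), th k * y ^ k +
      (Q * y ^ 3 * (1 - A * y) + g * y ^ 4) *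
        ∑ k ∈ Finset.range (M + 4), h k * (k * y ^ (k - 1)) =
    ∑ m ∈ Finset.range (M + 1), y ^ (m + 3) * (th (m + 3) - 2 * A * th (m + 2) + A ^ 2 * th (m + 1)
        + (m + 1) * Q * h (m + 1) - m * (Q * A - g) * h m) +
    y ^ (M + 4) * ((-2 * A * th (M + 3) + A ^ 2 * th (M + 2) + (M + 2) * Q * h (M + 2)
        - (M + 1) * (Q * A - g) * h (M + 1)) +
      y * (A ^ 2 * th (M + 3) + (M + 3) * Q * h (M + 3) - (M + 2) * (Q * A - g) * h (M + 2)) +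
      y ^ 2 * (- (M + 3) * (Q * A - g) * h (M + 3))) := by
  induction M with
  | zero =>
    simp [Finset.sum_range_succ, h0, t0, t1, h2, t2]
    ring
  | succ M ih =>
    rw [show M + 1 + 4 = (M + 4) + 1 by ring, Finset.sum_range_succ _ (M + 4),
      Finset.sum_range_succ _ (M + 4), Finset.sum_range_succ _ (M + 1)]
    have e1 : M + 4 - 1 = M + 3 := by omega
    have e2 : M + 1 + 3 = M + 4 := by omega
    have e3 : M + 1 + 2 = M + 3 := by omega
    have e4 : M + 1 + 1 = M + 2 := by omega
    simp only [e1, e2, e3, e4]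
    push_cast
    linear_combination ih

theorem lyap {l p q r s u v g : ℂ} (hl : l ≠ 0) (H : Fam l p q r s u v g)
    (h : ℕ → List (ℂ × ℕ × ℕ)) (M : ℕ) (η : ℂ)
    (h0 : h 0 = []) (h1 : h 1 = [(1, 0, 0)]) (h2 : h 2 = [])
    (hE : ∀ X Y : ℂ, X * Y = 1 → ∀ m ≤ M,
      thL (h (m + 3)) X Y - 2 * (p * X - q * Y) * thL (h (m + 2)) X Y
        + (p * X - q * Y) ^ 2 * thL (h (m + 1)) X Y
        + (m + 1) * (r * X + s * Y + u * X ^ 3 + v * Y ^ 3) * evL (h (m + 1)) X Y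
        - m * ((r * X + s * Y + u * X ^ 3 + v * Y ^ 3) * (p * X - q * Y) - g) * evL (h m) X Y
        = if m = M then η else 0) : η = 0 := by
  by_contra hη
  obtain ⟨K, ε, hε, H⟩ := H
  set A : ℝ → ℂ := fun t => p * Xf l t - q * Yf l t with hA
  set Q : ℝ → ℂ := fun t => r * Xf l t + s * Yf l t + u * Xf l t ^ 3 + v * Yf l t ^ 3 with hQ
  set ev : ℕ → ℝ → ℂ := fun k t => evL (h k) (Xf l t) (Yf l t) with hev
  set th : ℕ → ℝ → ℂ := fun k t => thL (h k) (Xf l t) (Yf l t) with hth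
  have cX := Xf_cont l
  have cY := Yf_cont l
  have cA : Continuous A := by fun_prop
  have cQ : Continuous Q := by fun_prop
  have cev : ∀ k, Continuous (ev k) := fun k => evL_cont _ _
  have cth : ∀ k, Continuous (th k) := fun k => thL_cont _ _
  obtain ⟨R, cR, hR⟩ : ∃ R : ℝ → ℂ → ℂ, Continuous (fun x : ℝ × ℂ => R x.1 x.2) ∧ ∀ t y,
      (1 - A t * y) ^ 2 * ∑ k ∈ Finset.range (M + 4), th k t * y ^ k +
      (Q t * y ^ 3 * (1 - A t * y) + g * y ^ 4) *
        ∑ k ∈ Finset.range (M + 4), ev k t * (k * y ^ (k - 1)) =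
      η * y ^ (M + 3) + y ^ (M + 4) * R t y := by
    refine ⟨fun t y => ((-2 * A t * th (M + 3) t + A t ^ 2 * th (M + 2) t
          + (M + 2) * Q t * ev (M + 2) t
          - (M + 1) * (Q t * A t - g) * ev (M + 1) t) +
        y * (A t ^ 2 * th (M + 3) t + (M + 3) * Q t * ev (M + 3) t
          - (M + 2) * (Q t * A t - g) * ev (M + 2) t) +
        y ^ 2 * (- (M + 3) * (Q t * A t - g) * ev (M + 3) t)), by fun_prop, ?_⟩
    intro t y
    rw [alg_id (fun k => ev k t) (fun k => th k t) (A t) (Q t) g y (by simp [hev, h0, evL])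
      (by simp [hth, h0, thL]) (by simp [hth, h1, thL]) (by simp [hev, h2, evL])
      (by simp [hth, h2, thL]) M]
    congr 1
    rw [Finset.sum_eq_single M]
    · have := hE _ _ (XY_one hl t) M le_rfl
      simp only [if_true] at this
      rw [mul_comm]
      congr 1
    · intro m hm hne
      have := hE _ _ (XY_one hl t) m (by simpa [Nat.lt_succ_iff] using hm)
      rw [if_neg hne] at this
      exact mul_eq_zero_of_right _ this
    · simp
  -- uniform smallness
  have hU : ∀ᶠ x : ℂ × ℂ in nhds (0, 1), ∀ t ∈ Set.Icc (0 : ℝ) (2 * Real.pi),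
      ‖(η * x.2 ^ (M + 3) + x.1 * x.2 ^ (M + 4) * R t (x.1 * x.2)) / (1 - A t * (x.1 * x.2)) ^ 2
        - η‖ < ‖η‖ / 2 := by
    apply IsCompact.eventually_forall_of_forall_eventually isCompact_Icc
    intro t _
    have hc : ContinuousAt (fun z : (ℂ × ℂ) × ℝ =>
        ‖(η * z.1.2 ^ (M + 3) + z.1.1 * z.1.2 ^ (M + 4) * R z.2 (z.1.1 * z.1.2)) /
          (1 - A z.2 * (z.1.1 * z.1.2)) ^ 2 - η‖) (((0 : ℂ), (1 : ℂ)), t) := by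
      have c1 : Continuous (fun z : (ℂ × ℂ) × ℝ => R z.2 (z.1.1 * z.1.2)) :=
        cR.comp (f := fun z : (ℂ × ℂ) × ℝ => (z.2, z.1.1 * z.1.2)) (by fun_prop)
      refine ContinuousAt.norm (ContinuousAt.sub (ContinuousAt.div ?_ ?_ ?_) continuousAt_const)
      · exact Continuous.continuousAt (by fun_prop)
      · exact Continuous.continuousAt (by fun_prop)
      · simp
    refine hc.eventually_lt continuousAt_const ?_
    simpa using hη
  obtain ⟨ρ, hρ, hU⟩ := Metric.eventually_nhds_iff.1 hU
  -- choose c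
  obtain ⟨c, hc0, hcε, hcρ, hcK⟩ : ∃ c : ℂ, 0 < ‖c‖ ∧ ‖c‖ < ε ∧ ‖c‖ < ρ ∧ K * ‖c‖ < ρ := by
    have hK : 0 < |K| + 1 := by positivity
    have hm : 0 < min (min ε ρ) (ρ / (|K| + 1)) / 2 := by positivity
    refine ⟨((min (min ε ρ) (ρ / (|K| + 1)) / 2 : ℝ) : ℂ), ?_⟩
    rw [norm_real, Real.norm_of_nonneg hm.le]
    set m := min (min ε ρ) (ρ / (|K| + 1)) / 2 with hmdef
    have a1 : m < min (min ε ρ) (ρ / (|K| + 1)) := by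
      rw [hmdef] at hm ⊢; linarith
    have a2 := lt_of_lt_of_le a1 (min_le_left _ _)
    have a3 := lt_of_lt_of_le a1 (min_le_right _ _)
    rw [lt_div_iff₀ hK] at a3
    refine ⟨hm, lt_of_lt_of_le a2 (min_le_left _ _), lt_of_lt_of_le a2 (min_le_right _ _), ?_⟩
    nlinarith [le_abs_self K]
  obtain ⟨y, hyp, hy⟩ := H c hc0 hcε
  have hcne : c ≠ 0 := norm_pos_iff.1 hc0
  set V : ℝ → ℂ := fun t => ∑ k ∈ Finset.range (M + 4), ev k t * y t ^ k with hV
  have hVd : ∀ t ∈ Set.Icc (0 : ℝ) (2 * Real.pi), HasDerivAt V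
      (I * ((η * y t ^ (M + 3) + y t ^ (M + 4) * R t (y t)) / (1 - A t * y t) ^ 2)) t := by
    intro t ht
    obtain ⟨-, hne, hd⟩ := hy t ht
    have key : HasDerivAt V (∑ k ∈ Finset.range (M + 4), (I * th k t * y t ^ k + ev k t *
        (k * y t ^ (k - 1) * (I * (Q t * y t ^ 3 / (1 - A t * y t)
        + g * y t ^ 4 / (1 - A t * y t) ^ 2))))) t := by
      apply HasDerivAt.fun_sum
      intro k _
      exact (evL_deriv (h k) l t).mul (hd.pow k)
    convert key using 1
    rw [← hR t (y t)]
    have hne' : 1 - A t * y t ≠ 0 := hne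
    rw [Finset.sum_add_distrib]
    have e1 : ∑ k ∈ Finset.range (M + 4), I * th k t * y t ^ k =
        I * ∑ k ∈ Finset.range (M + 4), th k t * y t ^ k := by
      rw [Finset.mul_sum]; exact Finset.sum_congr rfl fun _ _ => by ring
    have e2 : ∑ k ∈ Finset.range (M + 4), ev k t *
        (k * y t ^ (k - 1) * (I * (Q t * y t ^ 3 / (1 - A t * y t)
        + g * y t ^ 4 / (1 - A t * y t) ^ 2))) =
        (I * (Q t * y t ^ 3 / (1 - A t * y t) + g * y t ^ 4 / (1 - A t * y t) ^ 2)) *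
        ∑ k ∈ Finset.range (M + 4), ev k t * (k * y t ^ (k - 1)) := by
      rw [Finset.mul_sum]; exact Finset.sum_congr rfl fun _ _ => by ring
    rw [e1, e2]
    generalize ∑ k ∈ Finset.range (M + 4), th k t * y t ^ k = S1
    generalize ∑ k ∈ Finset.range (M + 4), ev k t * (k * y t ^ (k - 1)) = S2
    generalize 1 - A t * y t = B at hne' ⊢
    field_simp
  have hW : ∀ t ∈ Set.Icc (0 : ℝ) (2 * Real.pi), HasDerivWithinAt
      (fun t : ℝ => V t / c ^ (M + 3) - I * η * t)
      (I * ((η * y t ^ (M + 3) + y t ^ (M + 4) * R t (y t)) / (1 - A t * y t) ^ 2) / c ^ (M + 3)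
        - I * η) (Set.Icc (0 : ℝ) (2 * Real.pi)) t := by
    intro t ht
    exact (((hVd t ht).div_const (c ^ (M + 3))).fun_sub
      ((ofRealCLM.hasDerivAt (x := t)).const_mul (I * η))).hasDerivWithinAt.congr_deriv (by simp)
  have hpi := Real.pi_pos
  have hbd : ∀ t ∈ Set.Icc (0 : ℝ) (2 * Real.pi),
      ‖I * ((η * y t ^ (M + 3) + y t ^ (M + 4) * R t (y t)) / (1 - A t * y t) ^ 2) / c ^ (M + 3)
        - I * η‖ ≤ ‖η‖ / 2 := by
    intro t ht
    have hyc : ‖y t / c - 1‖ < ρ := by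
      have : y t / c - 1 = (y t - c) / c := by field_simp
      rw [this, norm_div, div_lt_iff₀ hc0]
      refine lt_of_le_of_lt (hy t ht).1 ?_
      nlinarith
    have := hU (y := (c, y t / c)) (by
      rw [Prod.dist_eq, dist_eq_norm, dist_eq_norm]
      simpa using ⟨hcρ, hyc⟩) t ht
    have e : c * (y t / c) = y t := by field_simp
    simp only [e] at this
    refine le_trans (le_of_eq ?_) this.le
    have e' : I * ((η * y t ^ (M + 3) + y t ^ (M + 4) * R t (y t)) / (1 - A t * y t) ^ 2) /
        c ^ (M + 3) - I * η = I * ((η * (y t / c) ^ (M + 3) + c * (y t / c) ^ (M + 4) * R t (y t)) /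
        (1 - A t * y t) ^ 2 - η) := by
      have hne' : 1 - A t * y t ≠ 0 := (hy t ht).2.1
      generalize 1 - A t * y t = B at hne' ⊢
      have : c * (y t / c) ^ (M + 4) = y t ^ (M + 4) / c ^ (M + 3) := by
        rw [div_pow, pow_succ c (M + 3)]
        field_simp
      rw [this, div_pow]
      ring
    rw [e', norm_mul, norm_I, one_mul]
  have fin := Convex.norm_image_sub_le_of_norm_hasDerivWithin_le hW hbd (convex_Icc _ _)
    (Set.left_mem_Icc.2 (by positivity)) (Set.right_mem_Icc.2 (by positivity))
  have hVp : V (2 * Real.pi) = V 0 := by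
    simp only [hV, hev, Xf_per, Yf_per, hyp]
  rw [hVp] at fin
  have e : V 0 / c ^ (M + 3) - I * η * ((2 * Real.pi : ℝ) : ℂ) -
      (V 0 / c ^ (M + 3) - I * η * ((0 : ℝ) : ℂ)) = -(I * η * ((2 * Real.pi : ℝ) : ℂ)) := by
    simp
  rw [e, norm_neg, norm_mul, norm_mul, norm_I, norm_real, sub_zero, one_mul] at fin
  have h3 : 0 < ‖(2 * Real.pi : ℝ)‖ := norm_pos_iff.2 (by positivity)
  have h4 : 0 < ‖η‖ := norm_pos_iff.2 hη
  nlinarith [mul_pos h3 h4]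

noncomputable def h_e4 (p q r s u v g : ℂ) : ℕ → List (ℂ × ℕ × ℕ)
  | 0 => []
  | 1 => [(1, 0, 0)]
  | 2 => []
  | 3 => [(1/3*v, 0, 3), (s, 0, 1), (-r, 1, 0), (-1/3*u, 3, 0)]
  | 4 => [(-1/4*q*v, 0, 4), (-1/2*q*s + 1/2*p*v, 0, 2), (1/2*q*u - 1/2*p*r, 2, 0), (-1/4*p*u, 4, 0)]
  | _ => []

theorem e4 (l p q r s u v g : ℂ) (hl : l ≠ 0) (H : Fam l (p) (q) (r) (s) (u) (v) (g)) :
    g - q*r + p*s = 0 := by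
  refine lyap hl H (h_e4 p q r s u v g) 1 _ rfl rfl rfl ?_
  intro X Y hXY m hm
  interval_cases m
  · simp only [thL, evL, List.map_cons, List.map_nil, List.sum_cons, List.sum_nil,
      Nat.reduceAdd, Nat.cast_zero, Nat.cast_one, Nat.cast_ofNat, reduceIte, Nat.reduceEqDiff, h_e4]
    linear_combination (0) * hXY
  · simp only [thL, evL, List.map_cons, List.map_nil, List.sum_cons, List.sum_nil,
      Nat.reduceAdd, Nat.cast_zero, Nat.cast_one, Nat.cast_ofNat, reduceIte, Nat.reduceEqDiff, h_e4]
    linear_combination (-q*u*X^2 - q*r + p*v*Y^2 + p*s) * hXY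

noncomputable def h_ep6 (p r s u v : ℂ) : ℕ → List (ℂ × ℕ × ℕ)
  | 0 => []
  | 1 => [(1, 0, 0)]
  | 2 => []
  | 3 => [(1/3*v, 0, 3), (s, 0, 1), (-r, 1, 0), (-1/3*u, 3, 0)]
  | 4 => [(1/2*p*v, 0, 2), (-1/2*p*r, 2, 0), (-1/4*p*u, 4, 0)]
  | 5 => [(1/6*v^2, 0, 6), (s*v, 0, 4), (3/2*s^2 - r*v, 0, 2), (p^2*v, 0, 1), (p^2*s, 1, 0), (-s*u +
      3/2*r^2, 2, 0), (-1/3*p^2*r, 3, 0), (r*u, 4, 0), (-1/5*p^2*u, 5, 0), (1/6*u^2, 6, 0)]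
  | 6 => [(3/5*p*v^2, 0, 5), (5/3*p*s*v, 0, 3), (-2*p*r*v, 0, 1), (-p*u*v - p*r*s, 1, 0), (p^3*s, 2,
      0), (-2/3*p*s*u + 5/3*p*r^2, 3, 0), (-1/4*p^3*r, 4, 0), (7/5*p*r*u, 5, 0), (-1/6*p^3*u, 6,
      0), (2/7*p*u^2, 7, 0)]
  | _ => []

theorem ep6 (l p r s u v : ℂ) (hl : l ≠ 0) (H : Fam l (p) (0) (r) (s) (u) (v) (-p*s)) :
    p^3*v = 0 := by
  refine lyap hl H (h_ep6 p r s u v) 3 _ rfl rfl rfl ?_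
  intro X Y hXY m hm
  interval_cases m
  · simp only [thL, evL, List.map_cons, List.map_nil, List.sum_cons, List.sum_nil,
      Nat.reduceAdd, Nat.cast_zero, Nat.cast_one, Nat.cast_ofNat, reduceIte, Nat.reduceEqDiff, h_ep6]
    linear_combination (0) * hXY
  · simp only [thL, evL, List.map_cons, List.map_nil, List.sum_cons, List.sum_nil,
      Nat.reduceAdd, Nat.cast_zero, Nat.cast_one, Nat.cast_ofNat, reduceIte, Nat.reduceEqDiff, h_ep6]
    linear_combination (p*v*Y^2 + p*s) * hXY
  · simp only [thL, evL, List.map_cons, List.map_nil, List.sum_cons, List.sum_nil,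
      Nat.reduceAdd, Nat.cast_zero, Nat.cast_one, Nat.cast_ofNat, reduceIte, Nat.reduceEqDiff, h_ep6]
    linear_combination (2*s*u*X^2 - 2*r*v*Y^2 + p^2*v*Y - p^2*v*X*Y^2 - p^2*s*X) * hXY
  · simp only [thL, evL, List.map_cons, List.map_nil, List.sum_cons, List.sum_nil,
      Nat.reduceAdd, Nat.cast_zero, Nat.cast_one, Nat.cast_ofNat, reduceIte, Nat.reduceEqDiff, h_ep6]
    linear_combination (p*v^2*Y^5 + p*u*v*X + p*u*v*X^2*Y - p*u*v*X^3*Y^2 + 4*p*s*v*Y^3 - 3*p*s*u*X^3 + 3*p*s^2*Y -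
      2*p*r*v*Y - 2*p*r*s*X + p^3*v - p^3*v*X*Y) * hXY

noncomputable def h_ep7 (p r s u : ℂ) : ℕ → List (ℂ × ℕ × ℕ)
  | 0 => []
  | 1 => [(1, 0, 0)]
  | 2 => []
  | 3 => [(s, 0, 1), (-r, 1, 0), (-1/3*u, 3, 0)]
  | 4 => [(-1/2*p*r, 2, 0), (-1/4*p*u, 4, 0)]
  | 5 => [(3/2*s^2, 0, 2), (p^2*s, 1, 0), (-s*u + 3/2*r^2, 2, 0), (-1/3*p^2*r, 3, 0), (r*u, 4, 0),
      (-1/5*p^2*u, 5, 0), (1/6*u^2, 6, 0)]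
  | 6 => [(-p*r*s, 1, 0), (p^3*s, 2, 0), (-2/3*p*s*u + 5/3*p*r^2, 3, 0), (-1/4*p^3*r, 4, 0),
      (7/5*p*r*u, 5, 0), (-1/6*p^3*u, 6, 0), (2/7*p*u^2, 7, 0)]
  | 7 => [(5/2*s^3, 0, 3), (15/2*r*s^2, 0, 1), (-5/2*s^2*u - 15/2*r^2*s, 1, 0), (-14/3*p^2*r*s, 2, 0),
      (-5/2*r^3 + p^4*s, 3, 0), (-2*p^2*s*u + 5/3*p^2*r^2, 4, 0), (5/6*s*u^2 - 5/2*r^2*u -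
      1/5*p^4*r, 5, 0), (29/18*p^2*r*u, 6, 0), (-5/6*r*u^2 - 1/7*p^4*u, 7, 0), (3/8*p^2*u^2, 8,
      0), (-5/54*u^3, 9, 0)]
  | _ => []

theorem ep7 (l p r s u : ℂ) (hl : l ≠ 0) (H : Fam l (p) (0) (r) (s) (u) (0) (-p*s)) :
    2*p^2*s^2 = 0 := by
  refine lyap hl H (h_ep7 p r s u) 4 _ rfl rfl rfl ?_
  intro X Y hXY m hm
  interval_cases m
  · simp only [thL, evL, List.map_cons, List.map_nil, List.sum_cons, List.sum_nil,
      Nat.reduceAdd, Nat.cast_zero, Nat.cast_one, Nat.cast_ofNat, reduceIte, Nat.reduceEqDiff, h_ep7]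
    linear_combination (0) * hXY
  · simp only [thL, evL, List.map_cons, List.map_nil, List.sum_cons, List.sum_nil,
      Nat.reduceAdd, Nat.cast_zero, Nat.cast_one, Nat.cast_ofNat, reduceIte, Nat.reduceEqDiff, h_ep7]
    linear_combination (p*s) * hXY
  · simp only [thL, evL, List.map_cons, List.map_nil, List.sum_cons, List.sum_nil,
      Nat.reduceAdd, Nat.cast_zero, Nat.cast_one, Nat.cast_ofNat, reduceIte, Nat.reduceEqDiff, h_ep7]
    linear_combination (2*s*u*X^2 - p^2*s*X) * hXY
  · simp only [thL, evL, List.map_cons, List.map_nil, List.sum_cons, List.sum_nil,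
      Nat.reduceAdd, Nat.cast_zero, Nat.cast_one, Nat.cast_ofNat, reduceIte, Nat.reduceEqDiff, h_ep7]
    linear_combination (-3*p*s*u*X^3 + 3*p*s^2*Y - 2*p*r*s*X) * hXY
  · simp only [thL, evL, List.map_cons, List.map_nil, List.sum_cons, List.sum_nil,
      Nat.reduceAdd, Nat.cast_zero, Nat.cast_one, Nat.cast_ofNat, reduceIte, Nat.reduceEqDiff, h_ep7]
    linear_combination (5/6*s*u^2*X^5 + 5/2*s^2*u*X + 15/2*s^2*u*X^2*Y + 5*r*s*u*X^3 + 15/2*r*s^2*Y + 15/2*r^2*s*X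
      + 2*p^2*s^2 - 3*p^2*s^2*X*Y + 1/3*p^2*r*s*X^2) * hXY

noncomputable def h_eq6 (q r s u v : ℂ) : ℕ → List (ℂ × ℕ × ℕ)
  | 0 => []
  | 1 => [(1, 0, 0)]
  | 2 => []
  | 3 => [(1/3*v, 0, 3), (s, 0, 1), (-r, 1, 0), (-1/3*u, 3, 0)]
  | 4 => [(-1/4*q*v, 0, 4), (-1/2*q*s, 0, 2), (1/2*q*u, 2, 0)]
  | 5 => [(1/6*v^2, 0, 6), (1/5*q^2*v, 0, 5), (s*v, 0, 4), (1/3*q^2*s, 0, 3), (3/2*s^2 - r*v, 0, 2),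
      (-q^2*r, 0, 1), (-q^2*u, 1, 0), (-s*u + 3/2*r^2, 2, 0), (r*u, 4, 0), (1/6*u^2, 6, 0)]
  | 6 => [(-2/7*q*v^2, 0, 7), (-1/6*q^3*v, 0, 6), (-7/5*q*s*v, 0, 5), (-1/4*q^3*s, 0, 4), (-5/3*q*s^2
      + 2/3*q*r*v, 0, 3), (q^3*r, 0, 2), (q*u*v + q*r*s, 0, 1), (2*q*s*u, 1, 0), (-5/3*q*r*u, 3,
      0), (-3/5*q*u^2, 5, 0)]
  | _ => []

theorem eq6 (l q r s u v : ℂ) (hl : l ≠ 0) (H : Fam l (0) (q) (r) (s) (u) (v) (q*r)) :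
    -q^3*u = 0 := by
  refine lyap hl H (h_eq6 q r s u v) 3 _ rfl rfl rfl ?_
  intro X Y hXY m hm
  interval_cases m
  · simp only [thL, evL, List.map_cons, List.map_nil, List.sum_cons, List.sum_nil,
      Nat.reduceAdd, Nat.cast_zero, Nat.cast_one, Nat.cast_ofNat, reduceIte, Nat.reduceEqDiff, h_eq6]
    linear_combination (0) * hXY
  · simp only [thL, evL, List.map_cons, List.map_nil, List.sum_cons, List.sum_nil,
      Nat.reduceAdd, Nat.cast_zero, Nat.cast_one, Nat.cast_ofNat, reduceIte, Nat.reduceEqDiff, h_eq6]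
    linear_combination (-q*u*X^2 - q*r) * hXY
  · simp only [thL, evL, List.map_cons, List.map_nil, List.sum_cons, List.sum_nil,
      Nat.reduceAdd, Nat.cast_zero, Nat.cast_one, Nat.cast_ofNat, reduceIte, Nat.reduceEqDiff, h_eq6]
    linear_combination (2*s*u*X^2 - 2*r*v*Y^2 + q^2*u*X - q^2*u*X^2*Y - q^2*r*Y) * hXY
  · simp only [thL, evL, List.map_cons, List.map_nil, List.sum_cons, List.sum_nil,
      Nat.reduceAdd, Nat.cast_zero, Nat.cast_one, Nat.cast_ofNat, reduceIte, Nat.reduceEqDiff, h_eq6]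
    linear_combination (q*u*v*Y + q*u*v*X*Y^2 - q*u*v*X^2*Y^3 + q*u^2*X^5 - 2*q*s*u*X - 3*q*r*v*Y^3 + 4*q*r*u*X^3 -
      2*q*r*s*Y + 3*q*r^2*X - q^3*u + q^3*u*X*Y) * hXY

noncomputable def h_eq7 (q r s v : ℂ) : ℕ → List (ℂ × ℕ × ℕ)
  | 0 => []
  | 1 => [(1, 0, 0)]
  | 2 => []
  | 3 => [(1/3*v, 0, 3), (s, 0, 1), (-r, 1, 0)]
  | 4 => [(-1/4*q*v, 0, 4), (-1/2*q*s, 0, 2)]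
  | 5 => [(1/6*v^2, 0, 6), (1/5*q^2*v, 0, 5), (s*v, 0, 4), (1/3*q^2*s, 0, 3), (3/2*s^2 - r*v, 0, 2),
      (-q^2*r, 0, 1), (3/2*r^2, 2, 0)]
  | 6 => [(-2/7*q*v^2, 0, 7), (-1/6*q^3*v, 0, 6), (-7/5*q*s*v, 0, 5), (-1/4*q^3*s, 0, 4), (-5/3*q*s^2
      + 2/3*q*r*v, 0, 3), (q^3*r, 0, 2), (q*r*s, 0, 1)]
  | 7 => [(5/54*v^3, 0, 9), (3/8*q^2*v^2, 0, 8), (5/6*s*v^2 + 1/7*q^4*v, 0, 7), (29/18*q^2*s*v, 0, 6),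
      (5/2*s^2*v - 5/6*r*v^2 + 1/5*q^4*s, 0, 5), (5/3*q^2*s^2 - 2*q^2*r*v, 0, 4), (5/2*s^3 -
      q^4*r, 0, 3), (-14/3*q^2*r*s, 0, 2), (15/2*r*s^2 + 5/2*r^2*v, 0, 1), (-15/2*r^2*s, 1, 0),
      (-5/2*r^3, 3, 0)]
  | _ => []

theorem eq7 (l q r s v : ℂ) (hl : l ≠ 0) (H : Fam l (0) (q) (r) (s) (0) (v) (q*r)) :
    -2*q^2*r^2 = 0 := by
  refine lyap hl H (h_eq7 q r s v) 4 _ rfl rfl rfl ?_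
  intro X Y hXY m hm
  interval_cases m
  · simp only [thL, evL, List.map_cons, List.map_nil, List.sum_cons, List.sum_nil,
      Nat.reduceAdd, Nat.cast_zero, Nat.cast_one, Nat.cast_ofNat, reduceIte, Nat.reduceEqDiff, h_eq7]
    linear_combination (0) * hXY
  · simp only [thL, evL, List.map_cons, List.map_nil, List.sum_cons, List.sum_nil,
      Nat.reduceAdd, Nat.cast_zero, Nat.cast_one, Nat.cast_ofNat, reduceIte, Nat.reduceEqDiff, h_eq7]
    linear_combination (-q*r) * hXY
  · simp only [thL, evL, List.map_cons, List.map_nil, List.sum_cons, List.sum_nil,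
      Nat.reduceAdd, Nat.cast_zero, Nat.cast_one, Nat.cast_ofNat, reduceIte, Nat.reduceEqDiff, h_eq7]
    linear_combination (-2*r*v*Y^2 - q^2*r*Y) * hXY
  · simp only [thL, evL, List.map_cons, List.map_nil, List.sum_cons, List.sum_nil,
      Nat.reduceAdd, Nat.cast_zero, Nat.cast_one, Nat.cast_ofNat, reduceIte, Nat.reduceEqDiff, h_eq7]
    linear_combination (-3*q*r*v*Y^3 - 2*q*r*s*Y + 3*q*r^2*X) * hXY
  · simp only [thL, evL, List.map_cons, List.map_nil, List.sum_cons, List.sum_nil,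
      Nat.reduceAdd, Nat.cast_zero, Nat.cast_one, Nat.cast_ofNat, reduceIte, Nat.reduceEqDiff, h_eq7]
    linear_combination (5/6*r*v^2*Y^5 + 5*r*s*v*Y^3 + 15/2*r*s^2*Y + 5/2*r^2*v*Y + 15/2*r^2*v*X*Y^2 + 15/2*r^2*s*X
      - 1/3*q^2*r*s*Y^2 - 2*q^2*r^2 + 3*q^2*r^2*X*Y) * hXY

noncomputable def h_e6 (s u v g : ℂ) : ℕ → List (ℂ × ℕ × ℕ)
  | 0 => []
  | 1 => [(1, 0, 0)]
  | 2 => []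
  | 3 => [(1/3*v, 0, 3), (s, 0, 1), (-g - s, 1, 0), (-1/3*u, 3, 0)]
  | 4 => [(-1/4*v, 0, 4), (1/2*v - 1/2*s, 0, 2), (-1/2*g + 1/2*u - 1/2*s, 2, 0), (-1/4*u, 4, 0)]
  | 5 => [(1/6*v^2, 0, 6), (1/5*v, 0, 5), (s*v, 0, 4), (-2/3*v + 1/3*s, 0, 3), (-v*g - s*v + 3/2*s^2,
      0, 2), (-g + v - s, 0, 1), (-u + s, 1, 0), (3/2*g^2 + 3*s*g - s*u + 3/2*s^2, 2, 0), (-1/3*g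
      + 2/3*u - 1/3*s, 3, 0), (u*g + s*u, 4, 0), (-1/5*u, 5, 0), (1/6*u^2, 6, 0)]
  | 6 => [(-2/7*v^2, 0, 7), (-1/6*v, 0, 6), (3/5*v^2 - 7/5*s*v, 0, 5), (3/4*v - 1/4*s, 0, 4), (2/3*v*g
      + 7/3*s*v - 5/3*s^2, 0, 3), (g - 3/2*v + s, 0, 2), (-2*v*g + u*v + s*g - 2*s*v + s^2, 0, 1),
      (-u*v - s*g + 2*s*u - s^2, 1, 0), (-3/2*u + s, 2, 0), (5/3*g^2 - 5/3*u*g + 10/3*s*g -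
      7/3*s*u + 5/3*s^2, 3, 0), (-1/4*g + 3/4*u - 1/4*s, 4, 0), (7/5*u*g - 3/5*u^2 + 7/5*s*u, 5,
      0), (-1/6*u, 6, 0), (2/7*u^2, 7, 0)]
  | _ => []

theorem e6 (l s u v g : ℂ) (hl : l ≠ 0) (H : Fam l (1) (1) (g + s) (s) (u) (v) (g)) :
    -3*g + v - u = 0 := by
  refine lyap hl H (h_e6 s u v g) 3 _ rfl rfl rfl ?_
  intro X Y hXY m hm
  interval_cases m
  · simp only [thL, evL, List.map_cons, List.map_nil, List.sum_cons, List.sum_nil,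
      Nat.reduceAdd, Nat.cast_zero, Nat.cast_one, Nat.cast_ofNat, reduceIte, Nat.reduceEqDiff, h_e6]
    linear_combination (0) * hXY
  · simp only [thL, evL, List.map_cons, List.map_nil, List.sum_cons, List.sum_nil,
      Nat.reduceAdd, Nat.cast_zero, Nat.cast_one, Nat.cast_ofNat, reduceIte, Nat.reduceEqDiff, h_e6]
    linear_combination (-g + v*Y^2 - u*X^2) * hXY
  · simp only [thL, evL, List.map_cons, List.map_nil, List.sum_cons, List.sum_nil,
      Nat.reduceAdd, Nat.cast_zero, Nat.cast_one, Nat.cast_ofNat, reduceIte, Nat.reduceEqDiff, h_e6]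
    linear_combination (-g*Y + v*Y - v*X*Y^2 - 2*v*g*Y^2 + u*X - u*X^2*Y - s*Y - s*X - 2*s*v*Y^2 + 2*s*u*X^2) * hXY
  · simp only [thL, evL, List.map_cons, List.map_nil, List.sum_cons, List.sum_nil,
      Nat.reduceAdd, Nat.cast_zero, Nat.cast_one, Nat.cast_ofNat, reduceIte, Nat.reduceEqDiff, h_e6]
    linear_combination (-3*g - g*X*Y + 3*g^2*X + v - v*Y^2 - v*X*Y + v*X*Y^3 - 2*v*g*Y - 3*v*g*Y^3 + v^2*Y^5 - u +
      u*X*Y + u*X^2 - u*X^3*Y + 4*u*g*X^3 + u*v*Y + u*v*X + u*v*X*Y^2 + u*v*X^2*Y - u*v*X^2*Y^3 -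
      u*v*X^3*Y^2 + u^2*X^5 - 2*s*g*Y + 4*s*g*X - 2*s*v*Y + s*v*Y^3 - 2*s*u*X + s*u*X^3 + s^2*Y +
      s^2*X) * hXY

noncomputable def h_e7 (s u g : ℂ) : ℕ → List (ℂ × ℕ × ℕ)
  | 0 => []
  | 1 => [(1, 0, 0)]
  | 2 => []
  | 3 => [(g + 1/3*u, 0, 3), (s, 0, 1), (-g - s, 1, 0), (-1/3*u, 3, 0)]
  | 4 => [(-3/4*g - 1/4*u, 0, 4), (3/2*g + 1/2*u - 1/2*s, 0, 2), (-1/2*g + 1/2*u - 1/2*s, 2, 0),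
      (-1/4*u, 4, 0)]
  | 5 => [(3/2*g^2 + u*g + 1/6*u^2, 0, 6), (3/5*g + 1/5*u, 0, 5), (3*s*g + s*u, 0, 4), (-2*g - 2/3*u +
      1/3*s, 0, 3), (-3*g^2 - u*g - 3*s*g - s*u + 3/2*s^2, 0, 2), (2*g + u - s, 0, 1), (-u + s, 1,
      0), (3/2*g^2 + 3*s*g - s*u + 3/2*s^2, 2, 0), (-1/3*g + 2/3*u - 1/3*s, 3, 0), (u*g + s*u, 4,
      0), (-1/5*u, 5, 0), (1/6*u^2, 6, 0)]
  | 6 => [(-18/7*g^2 - 12/7*u*g - 2/7*u^2, 0, 7), (-1/2*g - 1/6*u, 0, 6), (27/5*g^2 + 18/5*u*g +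
      3/5*u^2 - 21/5*s*g - 7/5*s*u, 0, 5), (9/4*g + 3/4*u - 1/4*s, 0, 4), (2*g^2 + 2/3*u*g + 7*s*g
      + 7/3*s*u - 5/3*s^2, 0, 3), (-7/2*g - 3/2*u + s, 0, 2), (-6*g^2 + u*g + u^2 - 5*s*g - 2*s*u
      + s^2, 0, 1), (-3*u*g - u^2 - s*g + 2*s*u - s^2, 1, 0), (-3/2*u + s, 2, 0), (5/3*g^2 -
      5/3*u*g + 10/3*s*g - 7/3*s*u + 5/3*s^2, 3, 0), (-1/4*g + 3/4*u - 1/4*s, 4, 0), (7/5*u*g -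
      3/5*u^2 + 7/5*s*u, 5, 0), (-1/6*u, 6, 0), (2/7*u^2, 7, 0)]
  | 7 => [(5/2*g^3 + 5/2*u*g^2 + 5/6*u^2*g + 5/54*u^3, 0, 9), (27/8*g^2 + 9/4*u*g + 3/8*u^2, 0, 8),
      (3/7*g + 1/7*u + 15/2*s*g^2 + 5*s*u*g + 5/6*s*u^2, 0, 7), (-25/2*g^2 - 25/3*u*g - 25/18*u^2
      + 29/6*s*g + 29/18*s*u, 0, 6), (-12/5*g - 15/2*g^3 - 4/5*u - 5*u*g^2 - 5/6*u^2*g + 1/5*s -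
      15/2*s*g^2 - 5*s*u*g - 5/6*s*u^2 + 15/2*s^2*g + 5/2*s^2*u, 0, 5), (12*g^2 + 10*u*g + 2*u^2 -
      16*s*g - 16/3*s*u + 5/3*s^2, 0, 4), (5*g + 2*u + 5/2*u*g^2 + 5/3*u^2*g + 5/18*u^3 - s +
      5/2*s^3, 0, 3), (11/2*g^2 - 17/3*u*g - 5/2*u^2 + 113/6*s*g + 47/6*s*u - 14/3*s^2, 0, 2),
      (-4*g + 15/2*g^3 - 3*u + 5/2*u*g^2 + 2*s + 15*s*g^2 + 5*s*u*g + 15*s^2*g + 5/2*s^2*u +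
      15/2*s^3, 0, 1), (3*g + 3*u - 2*s - 15/2*s*g^2 - 15*s^2*g - 5/2*s^2*u - 15/2*s^3, 1, 0),
      (-3/2*u*g - 5/2*u^2 - 14/3*s*g + 47/6*s*u - 14/3*s^2, 2, 0), (-5/2*g^3 - 2*u - 5/6*u^2*g -
      5/18*u^3 + s - 15/2*s*g^2 - 15/2*s^2*g - 5/2*s^3, 3, 0), (5/3*g^2 - 10/3*u*g + 2*u^2 +
      10/3*s*g - 16/3*s*u + 5/3*s^2, 4, 0), (-1/5*g + 4/5*u - 5/2*u*g^2 - 1/5*s - 5*s*u*g +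
      5/6*s*u^2 - 5/2*s^2*u, 5, 0), (29/18*u*g - 25/18*u^2 + 29/18*s*u, 6, 0), (-1/7*u - 5/6*u^2*g
      - 5/6*s*u^2, 7, 0), (3/8*u^2, 8, 0), (-5/54*u^3, 9, 0)]
  | _ => []

theorem e7 (l s u g : ℂ) (hl : l ≠ 0) (H : Fam l (1) (1) (g + s) (s) (u) (3*g + u) (g)) :
    2*g^2 + 4/3*u*g = 0 := by
  refine lyap hl H (h_e7 s u g) 4 _ rfl rfl rfl ?_
  intro X Y hXY m hm
  interval_cases m
  · simp only [thL, evL, List.map_cons, List.map_nil, List.sum_cons, List.sum_nil,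
      Nat.reduceAdd, Nat.cast_zero, Nat.cast_one, Nat.cast_ofNat, reduceIte, Nat.reduceEqDiff, h_e7]
    linear_combination (0) * hXY
  · simp only [thL, evL, List.map_cons, List.map_nil, List.sum_cons, List.sum_nil,
      Nat.reduceAdd, Nat.cast_zero, Nat.cast_one, Nat.cast_ofNat, reduceIte, Nat.reduceEqDiff, h_e7]
    linear_combination (-g + 3*g*Y^2 + u*Y^2 - u*X^2) * hXY
  · simp only [thL, evL, List.map_cons, List.map_nil, List.sum_cons, List.sum_nil,
      Nat.reduceAdd, Nat.cast_zero, Nat.cast_one, Nat.cast_ofNat, reduceIte, Nat.reduceEqDiff, h_e7]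
    linear_combination (2*g*Y - 3*g*X*Y^2 - 6*g^2*Y^2 + u*Y + u*X - u*X*Y^2 - u*X^2*Y - 2*u*g*Y^2 - s*Y - s*X -
      6*s*g*Y^2 - 2*s*u*Y^2 + 2*s*u*X^2) * hXY
  · simp only [thL, evL, List.map_cons, List.map_nil, List.sum_cons, List.sum_nil,
      Nat.reduceAdd, Nat.cast_zero, Nat.cast_one, Nat.cast_ofNat, reduceIte, Nat.reduceEqDiff, h_e7]
    linear_combination (-3*g*Y^2 - 4*g*X*Y + 3*g*X*Y^3 - 6*g^2*Y - 9*g^2*Y^3 + 9*g^2*Y^5 + 3*g^2*X - u*Y^2 +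
      u*X*Y^3 + u*X^2 - u*X^3*Y + u*g*Y - 3*u*g*Y^3 + 6*u*g*Y^5 + 3*u*g*X + 3*u*g*X*Y^2 +
      3*u*g*X^2*Y - 3*u*g*X^2*Y^3 + 4*u*g*X^3 - 3*u*g*X^3*Y^2 + u^2*Y + u^2*Y^5 + u^2*X +
      u^2*X*Y^2 + u^2*X^2*Y - u^2*X^2*Y^3 - u^2*X^3*Y^2 + u^2*X^5 - 8*s*g*Y + 3*s*g*Y^3 + 4*s*g*X
      - 2*s*u*Y + s*u*Y^3 - 2*s*u*X + s*u*X^3 + s^2*Y + s^2*X) * hXY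
  · simp only [thL, evL, List.map_cons, List.map_nil, List.sum_cons, List.sum_nil,
      Nat.reduceAdd, Nat.cast_zero, Nat.cast_one, Nat.cast_ofNat, reduceIte, Nat.reduceEqDiff, h_e7]
    linear_combination (-4*g*Y + 3*g*Y^3 - 3*g*X + 6*g*X*Y^2 - 3*g*X*Y^4 - g*X^2*Y + 2*g^2 - 7*g^2*Y^2 + 27*g^2*Y^4
      - 9*g^2*Y^6 + 4*g^2*X*Y - 3*g^2*X*Y^3 - 9*g^2*X*Y^5 + 2*g^2*X^2 + g^2*X^2*Y^2 + 15/2*g^3*Y +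
      15/2*g^3*Y^5 + 45/2*g^3*X*Y^2 - 3*u*Y + u*Y^3 - 3*u*X + 2*u*X*Y^2 - u*X*Y^4 + 2*u*X^2*Y +
      u*X^3 - u*X^4*Y + 4/3*u*g - 34/3*u*g*Y^2 + 18*u*g*Y^4 - 6*u*g*Y^6 + 1/3*u*g*X*Y +
      5*u*g*X*Y^3 - 6*u*g*X*Y^5 + 1/3*u*g*X^2*Y^2 - 2*u*g*X^3*Y + 3*u*g*X^4 + 5/2*u*g^2*Y +
      15/2*u*g^2*Y^3 + 5*u*g^2*Y^5 + 15/2*u*g^2*X*Y^2 + 15/2*u*g^2*X*Y^4 + 15/2*u*g^2*X^2*Y^5 +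
      15*u*g^2*X^3*Y^2 - 3*u^2*Y^2 + 3*u^2*Y^4 - u^2*Y^6 + 2*u^2*X*Y^3 - u^2*X*Y^5 + 3*u^2*X^2 -
      2*u^2*X^3*Y - 3*u^2*X^4 + u^2*X^5*Y + u^2*X^6 + 5*u^2*g*Y^3 + 5/6*u^2*g*Y^5 + 5*u^2*g*X*Y^4
      + 5*u^2*g*X^2*Y^5 + 5/2*u^2*g*X^3 + 5*u^2*g*X^3*Y^2 + 5/2*u^2*g*X^4*Y + 5/2*u^2*g*X^5*Y^2 +
      5/6*u^3*Y^3 + 5/6*u^3*X*Y^4 + 5/6*u^3*X^2*Y^5 + 5/6*u^3*X^3 + 5/6*u^3*X^4*Y +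
      5/6*u^3*X^5*Y^2 + 2*s*Y + 2*s*X - s*X*Y^2 - s*X^2*Y + 59/3*s*g*Y^2 - 9*s*g*Y^4 + 7*s*g*X*Y -
      15*s*g*X*Y^3 + 13/3*s*g*X^2 + s*g*X^2*Y^2 + 15*s*g^2*Y + 15*s*g^2*Y^3 + 15/2*s*g^2*Y^5 +
      15/2*s*g^2*X + 45*s*g^2*X*Y^2 + 20/3*s*u*Y^2 - 3*s*u*Y^4 - 5*s*u*X*Y^3 - 20/3*s*u*X^2 +
      5*s*u*X^3*Y + 3*s*u*X^4 + 5*s*u*g*Y + 5*s*u*g*Y^3 + 5*s*u*g*Y^5 + 15*s*u*g*X*Y^2 +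
      15*s*u*g*X^2*Y^3 + 5*s*u*g*X^3 + 15*s*u*g*X^3*Y^2 + 5/6*s*u^2*Y^5 + 5*s*u^2*X^2*Y^3 +
      5*s*u^2*X^3*Y^2 + 5/6*s*u^2*X^5 - 7/3*s^2*Y^2 + 7/3*s^2*X^2 + 15*s^2*g*Y + 15*s^2*g*Y^3 +
      15*s^2*g*X + 45/2*s^2*g*X*Y^2 + 5/2*s^2*u*Y + 5*s^2*u*Y^3 + 5/2*s^2*u*X + 15/2*s^2*u*X*Y^2 +
      15/2*s^2*u*X^2*Y + 5*s^2*u*X^3 + 15/2*s^3*Y + 15/2*s^3*X) * hXY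

noncomputable def h_e8 (s g : ℂ) : ℕ → List (ℂ × ℕ × ℕ)
  | 0 => []
  | 1 => [(1, 0, 0)]
  | 2 => []
  | 3 => [(1/2*g, 0, 3), (s, 0, 1), (-g - s, 1, 0), (1/2*g, 3, 0)]
  | 4 => [(-3/8*g, 0, 4), (3/4*g - 1/2*s, 0, 2), (-5/4*g - 1/2*s, 2, 0), (3/8*g, 4, 0)]
  | 5 => [(3/8*g^2, 0, 6), (3/10*g, 0, 5), (3/2*s*g, 0, 4), (-g + 1/3*s, 0, 3), (-3/2*g^2 - 3/2*s*g +
      3/2*s^2, 0, 2), (1/2*g - s, 0, 1), (3/2*g + s, 1, 0), (3/2*g^2 + 9/2*s*g + 3/2*s^2, 2, 0),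
      (-4/3*g - 1/3*s, 3, 0), (-3/2*g^2 - 3/2*s*g, 4, 0), (3/10*g, 5, 0), (3/8*g^2, 6, 0)]
  | 6 => [(-9/14*g^2, 0, 7), (-1/4*g, 0, 6), (27/20*g^2 - 21/10*s*g, 0, 5), (9/8*g - 1/4*s, 0, 4),
      (g^2 + 7/2*s*g - 5/3*s^2, 0, 3), (-5/4*g + s, 0, 2), (-21/4*g^2 - 2*s*g + s^2, 0, 1),
      (9/4*g^2 - 4*s*g - s^2, 1, 0), (9/4*g + s, 2, 0), (25/6*g^2 + 41/6*s*g + 5/3*s^2, 3, 0),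
      (-11/8*g - 1/4*s, 4, 0), (-69/20*g^2 - 21/10*s*g, 5, 0), (1/4*g, 6, 0), (9/14*g^2, 7, 0)]
  | 7 => [(5/16*g^3, 0, 9), (27/32*g^2, 0, 8), (3/14*g + 15/8*s*g^2, 0, 7), (-25/8*g^2 + 29/12*s*g, 0,
      6), (-6/5*g - 15/8*g^3 + 1/5*s - 15/8*s*g^2 + 15/4*s^2*g, 0, 5), (3/2*g^2 - 8*s*g + 5/3*s^2,
      0, 4), (2*g - 15/16*g^3 - s + 5/2*s^3, 0, 3), (67/8*g^2 + 85/12*s*g - 14/3*s^2, 0, 2),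
      (1/2*g + 15/4*g^3 + 2*s + 15/2*s*g^2 + 45/4*s^2*g + 15/2*s^3, 0, 1), (-3/2*g - 2*s -
      15/2*s*g^2 - 45/4*s^2*g - 15/2*s^3, 1, 0), (-27/8*g^2 - 197/12*s*g - 14/3*s^2, 2, 0), (3*g -
      55/16*g^3 + s - 15/2*s*g^2 - 15/2*s^2*g - 5/2*s^3, 3, 0), (67/6*g^2 + 34/3*s*g + 5/3*s^2, 4,
      0), (-7/5*g + 15/4*g^3 - 1/5*s + 75/8*s*g^2 + 15/4*s^2*g, 5, 0), (-133/24*g^2 - 29/12*s*g,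
      6, 0), (3/14*g - 15/8*g^3 - 15/8*s*g^2, 7, 0), (27/32*g^2, 8, 0), (5/16*g^3, 9, 0)]
  | 8 => [(-963/1120*g^3, 0, 10), (-g^2, 0, 9), (-3/16*g + 1197/640*g^3 - 10047/2240*s*g^2, 0, 8),
      (285/56*g^2 - 73/28*s*g, 0, 7), (5/4*g + 153/56*g^3 - 1/6*s + 1359/140*s*g^2 - 309/40*s^2*g,
      0, 6), (-33/5*g^2 + 243/20*s*g - 49/30*s^2, 0, 5), (-11/4*g - 22359/2240*g^3 + s -
      147/32*s*g^2 + 723/80*s^2*g - 35/8*s^3, 0, 4), (-19/4*g^2 - 167/12*s*g + 41/6*s^2, 0, 3),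
      (3/4*g + 3/160*g^3 - 5/2*s - 183/10*s*g^2 - 55/8*s^2*g - 2*s^3, 0, 2), (187/8*g^2 +
      95/12*s*g - 10/3*s^2, 0, 1), (-97/8*g^2 + 175/12*s*g + 10/3*s^2, 1, 0), (-13/4*g -
      2151/160*g^3 - 5/2*s - 211/20*s*g^2 + 7/8*s^2*g - 2*s^3, 2, 0), (-16*g^2 - 331/12*s*g -
      41/6*s^2, 3, 0), (15/4*g - 3595/448*g^3 + s - 5727/160*s*g^2 - 1773/80*s^2*g - 35/8*s^3, 4,
      0), (1223/60*g^2 + 185/12*s*g + 49/30*s^2, 5, 0), (-17/12*g + 147/10*g^3 - 1/6*s +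
      1761/70*s*g^2 + 309/40*s^2*g, 6, 0), (-431/56*g^2 - 73/28*s*g, 7, 0), (3/16*g -
      28473/4480*g^3 - 10047/2240*s*g^2, 8, 0), (g^2, 9, 0), (963/1120*g^3, 10, 0)]
  | _ => []

theorem e8 (l s g : ℂ) (hl : l ≠ 0) (H : Fam l (1) (1) (g + s) (s) (-3/2*g) (3/2*g) (g)) :
    5*g + 3/4*g^3 = 0 := by
  refine lyap hl H (h_e8 s g) 5 _ rfl rfl rfl ?_
  intro X Y hXY m hm
  interval_cases m
  · simp only [thL, evL, List.map_cons, List.map_nil, List.sum_cons, List.sum_nil,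
      Nat.reduceAdd, Nat.cast_zero, Nat.cast_one, Nat.cast_ofNat, reduceIte, Nat.reduceEqDiff, h_e8]
    linear_combination (0) * hXY
  · simp only [thL, evL, List.map_cons, List.map_nil, List.sum_cons, List.sum_nil,
      Nat.reduceAdd, Nat.cast_zero, Nat.cast_one, Nat.cast_ofNat, reduceIte, Nat.reduceEqDiff, h_e8]
    linear_combination (-g + 3/2*g*Y^2 + 3/2*g*X^2) * hXY
  · simp only [thL, evL, List.map_cons, List.map_nil, List.sum_cons, List.sum_nil,
      Nat.reduceAdd, Nat.cast_zero, Nat.cast_one, Nat.cast_ofNat, reduceIte, Nat.reduceEqDiff, h_e8]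
    linear_combination (1/2*g*Y - 3/2*g*X - 3/2*g*X*Y^2 + 3/2*g*X^2*Y - 3*g^2*Y^2 - s*Y - s*X - 3*s*g*Y^2 -
      3*s*g*X^2) * hXY
  · simp only [thL, evL, List.map_cons, List.map_nil, List.sum_cons, List.sum_nil,
      Nat.reduceAdd, Nat.cast_zero, Nat.cast_one, Nat.cast_ofNat, reduceIte, Nat.reduceEqDiff, h_e8]
    linear_combination (-3/2*g*Y^2 - 4*g*X*Y + 3/2*g*X*Y^3 - 3/2*g*X^2 + 3/2*g*X^3*Y - 21/4*g^2*Y - 9/2*g^2*Y^3 +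
      9/4*g^2*Y^5 + 3/4*g^2*X - 9/4*g^2*X*Y^2 - 9/4*g^2*X^2*Y + 9/4*g^2*X^2*Y^3 - 6*g^2*X^3 +
      9/4*g^2*X^3*Y^2 + 9/4*g^2*X^5 - 5*s*g*Y + 3/2*s*g*Y^3 + 7*s*g*X - 3/2*s*g*X^3 + s^2*Y +
      s^2*X) * hXY
  · simp only [thL, evL, List.map_cons, List.map_nil, List.sum_cons, List.sum_nil,
      Nat.reduceAdd, Nat.cast_zero, Nat.cast_one, Nat.cast_ofNat, reduceIte, Nat.reduceEqDiff, h_e8]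
    linear_combination (1/2*g*Y + 3/2*g*Y^3 + 3/2*g*X + 3*g*X*Y^2 - 3/2*g*X*Y^4 - 4*g*X^2*Y - 3/2*g*X^3 +
      3/2*g*X^4*Y + 13/4*g^2*Y^2 + 27/4*g^2*Y^4 - 9/4*g^2*Y^6 + 7/2*g^2*X*Y - 6*g^2*X*Y^3 -
      9/4*g^2*X*Y^5 + 35/4*g^2*X^2 + 1/2*g^2*X^2*Y^2 - 3/2*g^2*X^3*Y - 45/4*g^2*X^4 +
      9/4*g^2*X^5*Y + 9/4*g^2*X^6 + 15/4*g^3*Y - 45/16*g^3*Y^3 + 15/8*g^3*Y^5 + 45/4*g^3*X*Y^2 -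
      45/16*g^3*X*Y^4 - 45/16*g^3*X^2*Y^5 + 45/16*g^3*X^3 - 45/4*g^3*X^3*Y^2 + 45/16*g^3*X^4*Y +
      45/16*g^3*X^5*Y^2 + 2*s*Y + 2*s*X - s*X*Y^2 - s*X^2*Y + 29/3*s*g*Y^2 - 9/2*s*g*Y^4 +
      7*s*g*X*Y - 15/2*s*g*X*Y^3 + 43/3*s*g*X^2 + s*g*X^2*Y^2 - 15/2*s*g*X^3*Y - 9/2*s*g*X^4 +
      15/2*s*g^2*Y + 15/2*s*g^2*Y^3 + 15/8*s*g^2*Y^5 + 15/2*s*g^2*X + 45/2*s*g^2*X*Y^2 -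
      45/4*s*g^2*X^2*Y^3 - 15/2*s*g^2*X^3 - 45/4*s*g^2*X^3*Y^2 + 15/8*s*g^2*X^5 - 7/3*s^2*Y^2 +
      7/3*s^2*X^2 + 45/4*s^2*g*Y + 15/2*s^2*g*Y^3 + 45/4*s^2*g*X + 45/4*s^2*g*X*Y^2 -
      45/4*s^2*g*X^2*Y - 15/2*s^2*g*X^3 + 15/2*s^3*Y + 15/2*s^3*X) * hXY
  · simp only [thL, evL, List.map_cons, List.map_nil, List.sum_cons, List.sum_nil,
      Nat.reduceAdd, Nat.cast_zero, Nat.cast_one, Nat.cast_ofNat, reduceIte, Nat.reduceEqDiff, h_e8]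
    linear_combination (5*g + 5/2*g*Y^2 - 3/2*g*Y^4 + 7*g*X*Y - 9/2*g*X*Y^3 + 3/2*g*X*Y^5 + 7/2*g*X^2 -
      11/2*g*X^3*Y - 3/2*g*X^4 + 3/2*g*X^5*Y + 167/8*g^2*Y + 19*g^2*Y^3 - 12*g^2*Y^5 + 9/4*g^2*Y^7
      + 37/8*g^2*X + 5/8*g^2*X*Y^2 - 33/4*g^2*X*Y^4 + 9/2*g^2*X*Y^6 + 99/8*g^2*X^2*Y -
      83/8*g^2*X^2*Y^3 + 395/12*g^2*X^3 - 61/8*g^2*X^3*Y^2 + 9/4*g^2*X^3*Y^4 - 69/4*g^2*X^4*Y +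
      9/4*g^2*X^4*Y^3 - 16*g^2*X^5 + 9/2*g^2*X^6*Y + 9/4*g^2*X^7 + 3/4*g^3 + 1203/80*g^3*Y^2 +
      951/560*g^3*Y^4 - 111/56*g^3*Y^6 + 45/16*g^3*Y^8 + 99/4*g^3*X*Y + 153/80*g^3*X*Y^3 +
      123/112*g^3*X*Y^5 + 471/80*g^3*X^2 + 69/4*g^3*X^2*Y^2 - 747/80*g^3*X^2*Y^4 +
      333/112*g^3*X^2*Y^6 - 2259/80*g^3*X^3*Y - 45/4*g^3*X^3*Y^3 + 45/16*g^3*X^3*Y^5 +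
      2433/112*g^3*X^4 - 1359/80*g^3*X^4*Y^2 + 333/112*g^3*X^5*Y + 45/16*g^3*X^5*Y^3 -
      105/8*g^3*X^6 + 333/112*g^3*X^6*Y^2 + 45/16*g^3*X^8 - s*Y^2 + s*X*Y^3 + s*X^2 - s*X^3*Y +
      155/12*s*g*Y - 145/12*s*g*Y^3 + 4*s*g*Y^5 - 235/12*s*g*X - 101/12*s*g*X*Y^2 + 9*s*g*X*Y^4 +
      181/12*s*g*X^2*Y - 11/4*s*g*X^2*Y^3 + 63/4*s*g*X^3 + 11/4*s*g*X^3*Y^2 - 9*s*g*X^4*Y -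
      4*s*g*X^5 + 87/5*s*g^2*Y^2 - 51/8*s*g^2*Y^4 + 78/7*s*g^2*Y^6 + 30*s*g^2*X*Y +
      339/10*s*g^2*X*Y^3 - 15/8*s*g^2*X*Y^5 - 59/10*s*g^2*X^2 + 15/2*s*g^2*X^2*Y^2 +
      153/20*s*g^2*X^2*Y^4 - 132/5*s*g^2*X^3*Y + 1347/40*s*g^2*X^4 - 153/20*s*g^2*X^4*Y^2 +
      15/8*s*g^2*X^5*Y - 78/7*s*g^2*X^6 - 10/3*s^2*Y + 11/6*s^2*Y^3 - 10/3*s^2*X + 10/3*s^2*X*Y^2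
      + 10/3*s^2*X^2*Y + 11/6*s^2*X^3 + 53/4*s^2*g*Y^2 + 273/20*s^2*g*Y^4 + 30*s^2*g*X*Y +
      15/4*s^2*g*X*Y^3 - 7/4*s^2*g*X^2 + 15/2*s^2*g*X^2*Y^2 + 15/4*s^2*g*X^3*Y + 273/20*s^2*g*X^4
      + 5*s^3*Y^2 - 5*s^3*X^2) * hXY

noncomputable def h_e9 (s g : ℂ) : ℕ → List (ℂ × ℕ × ℕ)
  | 0 => []
  | 1 => [(1, 0, 0)]
  | 2 => []
  | 3 => [(1/2*g, 0, 3), (s, 0, 1), (-g - s, 1, 0), (1/2*g, 3, 0)]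
  | 4 => [(-3/8*g, 0, 4), (3/4*g - 1/2*s, 0, 2), (-5/4*g - 1/2*s, 2, 0), (3/8*g, 4, 0)]
  | 5 => [(-5/2, 0, 6), (3/10*g, 0, 5), (3/2*s*g, 0, 4), (-g + 1/3*s, 0, 3), (10 - 3/2*s*g + 3/2*s^2,
      0, 2), (1/2*g - s, 0, 1), (3/2*g + s, 1, 0), (-10 + 9/2*s*g + 3/2*s^2, 2, 0), (-4/3*g -
      1/3*s, 3, 0), (10 - 3/2*s*g, 4, 0), (3/10*g, 5, 0), (-5/2, 6, 0)]
  | 6 => [(30/7, 0, 7), (-1/4*g, 0, 6), (-9 - 21/10*s*g, 0, 5), (9/8*g - 1/4*s, 0, 4), (-20/3 +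
      7/2*s*g - 5/3*s^2, 0, 3), (-5/4*g + s, 0, 2), (35 - 2*s*g + s^2, 0, 1), (-15 - 4*s*g - s^2,
      1, 0), (9/4*g + s, 2, 0), (-250/9 + 41/6*s*g + 5/3*s^2, 3, 0), (-11/8*g - 1/4*s, 4, 0), (23
      - 21/10*s*g, 5, 0), (1/4*g, 6, 0), (-30/7, 7, 0)]
  | 7 => [(-25/12*g, 0, 9), (-45/8, 0, 8), (3/14*g - 25/2*s, 0, 7), (125/6 + 29/12*s*g, 0, 6),
      (113/10*g + 127/10*s + 15/4*s^2*g, 0, 5), (-10 - 8*s*g + 5/3*s^2, 0, 4), (33/4*g - s +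
      5/2*s^3, 0, 3), (-335/6 + 85/12*s*g - 14/3*s^2, 0, 2), (-49/2*g - 48*s + 45/4*s^2*g +
      15/2*s^3, 0, 1), (-3/2*g + 48*s - 45/4*s^2*g - 15/2*s^3, 1, 0), (45/2 - 197/12*s*g -
      14/3*s^2, 2, 0), (311/12*g + 51*s - 15/2*s^2*g - 5/2*s^3, 3, 0), (-670/9 + 34/3*s*g +
      5/3*s^2, 4, 0), (-132/5*g - 627/10*s + 15/4*s^2*g, 5, 0), (665/18 - 29/12*s*g, 6, 0),
      (89/7*g + 25/2*s, 7, 0), (-45/8, 8, 0), (-25/12*g, 9, 0)]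
  | 8 => [(321/56*g, 0, 10), (20/3, 0, 9), (-405/32*g + 3349/112*s, 0, 8), (-475/14 - 73/28*s*g, 0,
      7), (-475/28*g - 2725/42*s - 309/40*s^2*g, 0, 6), (44 + 243/20*s*g - 49/30*s^2, 0, 5),
      (7145/112*g + 253/8*s + 723/80*s^2*g - 35/8*s^3, 0, 4), (95/3 - 167/12*s*g + 41/6*s^2, 0,
      3), (5/8*g + 239/2*s - 55/8*s^2*g - 2*s^3, 0, 2), (-935/6 + 95/12*s*g - 10/3*s^2, 0, 1),
      (485/6 + 175/12*s*g + 10/3*s^2, 1, 0), (691/8*g + 407/6*s + 7/8*s^2*g - 2*s^3, 2, 0), (320/3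
      - 331/12*s*g - 41/6*s^2, 3, 0), (19235/336*g + 1917/8*s - 1773/80*s^2*g - 35/8*s^3, 4, 0),
      (-1223/9 + 185/12*s*g + 49/30*s^2, 5, 0), (-1193/12*g - 7051/42*s + 309/40*s^2*g, 6, 0),
      (2155/42 - 73/28*s*g, 7, 0), (9533/224*g + 3349/112*s, 8, 0), (-20/3, 9, 0), (-321/56*g, 10,
      0)]
  | 9 => [(875/72, 0, 12), (-1185/112*g, 0, 11), (-15/2 - 175/12*s*g, 0, 10), (10565/252*g -
      75223/1512*s, 0, 9), (-7133/144 + 8311/480*s*g - 175/4*s^2, 0, 8), (-845/56*g + 31079/168*s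
      + 2423/210*s^2*g, 0, 7), (-6905/36 - 241/15*s*g + 287/180*s^2 + 35/4*s^3*g, 0, 6),
      (-54151/336*g - 23047/126*s - 2047/60*s^2*g + 35/6*s^3, 0, 5), (877/3 - 79/6*s*g -
      13639/60*s^2 + 105/4*s^3*g + 35/8*s^4, 0, 4), (-3355/84*g - 1625/18*s + 251/20*s^2*g -
      23/2*s^3, 0, 3), (5531/12 + 2289/20*s*g + 4385/12*s^2 + 35/4*s^3*g + 35*s^4, 0, 2), (605/3*g
      + 2131/9*s - 299/6*s^2*g - 110/3*s^3, 0, 1), (158/3*g - 917/3*s + 361/6*s^2*g + 110/3*s^3,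
      1, 0), (-1639/36 - 2839/20*s*g - 10315/12*s^2 + 525/4*s^3*g + 35*s^4, 2, 0), (-27719/252*g -
      5527/18*s + 941/20*s^2*g + 23/2*s^3, 3, 0), (6730/9 - 497/15*s*g + 7361/60*s^2 - 35/4*s^3*g
      + 35/8*s^4, 4, 0), (290387/1008*g + 95063/126*s - 3097/60*s^2*g - 35/6*s^3, 5, 0),
      (-75431/108 + 17483/90*s*g + 31787/180*s^2 - 35/4*s^3*g, 6, 0), (-69805/252*g - 170773/504*s
      + 2423/210*s^2*g, 7, 0), (5721/16 - 50311/480*s*g - 175/4*s^2, 8, 0), (138613/1512*g +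
      75223/1512*s, 9, 0), (-1885/18 + 175/12*s*g, 10, 0), (-1185/112*g, 11, 0), (875/72, 12, 0)]
  | _ => []

theorem e9 (l s g : ℂ) (hl : l ≠ 0) (hg : 3 * g ^ 2 + 20 = 0) (H : Fam l (1) (1) (g + s) (s) (-3/2*g) (3/2*g) (g)) :
    -185/3 + 37/2*s*g = 0 := by
  refine lyap hl H (h_e9 s g) 6 _ rfl rfl rfl ?_
  intro X Y hXY m hm
  interval_cases m
  · simp only [thL, evL, List.map_cons, List.map_nil, List.sum_cons, List.sum_nil,
      Nat.reduceAdd, Nat.cast_zero, Nat.cast_one, Nat.cast_ofNat, reduceIte, Nat.reduceEqDiff, h_e9]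
    linear_combination (0) * hXY + (0) * hg
  · simp only [thL, evL, List.map_cons, List.map_nil, List.sum_cons, List.sum_nil,
      Nat.reduceAdd, Nat.cast_zero, Nat.cast_one, Nat.cast_ofNat, reduceIte, Nat.reduceEqDiff, h_e9]
    linear_combination (-g + 3/2*g*Y^2 + 3/2*g*X^2) * hXY + (0) * hg
  · simp only [thL, evL, List.map_cons, List.map_nil, List.sum_cons, List.sum_nil,
      Nat.reduceAdd, Nat.cast_zero, Nat.cast_one, Nat.cast_ofNat, reduceIte, Nat.reduceEqDiff, h_e9]
    linear_combination (20*Y^2 + 1/2*g*Y - 3/2*g*X - 3/2*g*X*Y^2 + 3/2*g*X^2*Y - s*Y - s*X - 3*s*g*Y^2 - 3*s*g*X^2)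
      * hXY + (3/4*Y^6 - X*Y^3 - X^2 + 2*X^4 - 3/4*X^6) * hg
  · simp only [thL, evL, List.map_cons, List.map_nil, List.sum_cons, List.sum_nil,
      Nat.reduceAdd, Nat.cast_zero, Nat.cast_one, Nat.cast_ofNat, reduceIte, Nat.reduceEqDiff, h_e9]
    linear_combination (35*Y + 30*Y^3 - 15*Y^5 - 5*X + 15*X*Y^2 + 15*X^2*Y - 15*X^2*Y^3 + 40*X^3 - 15*X^3*Y^2 -
      15*X^5 - 3/2*g*Y^2 - 4*g*X*Y + 3/2*g*X*Y^3 - 3/2*g*X^2 + 3/2*g*X^3*Y - 5*s*g*Y + 3/2*s*g*Y^3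
      + 7*s*g*X - 3/2*s*g*X^3 + s^2*Y + s^2*X) * hXY + (1/2*Y^3 + 3/2*Y^5 - X + X*Y^2 - 3/2*X*Y^4
      - 3/4*X*Y^6 - X^2*Y - 3/2*X^2*Y^3 - 1/6*X^3 - 3/2*X^3*Y^2 + 3/4*X^3*Y^4 + 2*X^4*Y +
      3/4*X^4*Y^3 + X^5 - 3/4*X^6*Y) * hg
  · simp only [thL, evL, List.map_cons, List.map_nil, List.sum_cons, List.sum_nil,
      Nat.reduceAdd, Nat.cast_zero, Nat.cast_one, Nat.cast_ofNat, reduceIte, Nat.reduceEqDiff, h_e9]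
    linear_combination (-65/3*Y^2 - 45*Y^4 + 15*Y^6 - 70/3*X*Y + 40*X*Y^3 + 15*X*Y^5 - 175/3*X^2 - 10/3*X^2*Y^2 +
      10*X^3*Y + 75*X^4 - 15*X^5*Y - 15*X^6 - 49/2*g*Y + 81/4*g*Y^3 - 25/2*g*Y^5 + 3/2*g*X -
      72*g*X*Y^2 + 69/4*g*X*Y^4 - 4*g*X^2*Y + 75/4*g*X^2*Y^5 - 81/4*g*X^3 + 75*g*X^3*Y^2 -
      69/4*g*X^4*Y - 75/4*g*X^5*Y^2 - 48*s*Y - 50*s*Y^3 - 25/2*s*Y^5 - 48*s*X - 151*s*X*Y^2 -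
      s*X^2*Y + 75*s*X^2*Y^3 + 50*s*X^3 + 75*s*X^3*Y^2 - 25/2*s*X^5 + 29/3*s*g*Y^2 - 9/2*s*g*Y^4 +
      7*s*g*X*Y - 15/2*s*g*X*Y^3 + 43/3*s*g*X^2 + s*g*X^2*Y^2 - 15/2*s*g*X^3*Y - 9/2*s*g*X^4 -
      7/3*s^2*Y^2 + 7/3*s^2*X^2 + 45/4*s^2*g*Y + 15/2*s^2*g*Y^3 + 45/4*s^2*g*X + 45/4*s^2*g*X*Y^2
      - 45/4*s^2*g*X^2*Y - 15/2*s^2*g*X^3 + 15/2*s^3*Y + 15/2*s^3*X) * hXY + (Y^2 + 3/4*Y^4 - Y^6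
      + 5/6*X*Y + 37/12*X*Y^3 - 3/2*X*Y^5 + 3/4*X*Y^7 + 5/6*X^2 - X^2*Y^2 - 2*X^2*Y^4 -
      35/12*X^3*Y + 1/6*X^3*Y^3 - 137/36*X^4 + 3/2*X^4*Y^2 + 3*X^5*Y + 5/6*X^6 - 3/4*X^7*Y -
      15/4*s*Y^5 + 15/4*s*Y^7 - 5/2*s*X*Y^2 + 5/2*s*X*Y^4 + 45/4*s*X^2*Y^3 + 15/2*s*X^3 +
      15/4*s*X^3*Y^2 - 15/4*s*X^3*Y^4 - 15/4*s*X^4*Y^3 - 55/4*s*X^5 + 15/4*s*X^7) * hg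
  · simp only [thL, evL, List.map_cons, List.map_nil, List.sum_cons, List.sum_nil,
      Nat.reduceAdd, Nat.cast_zero, Nat.cast_one, Nat.cast_ofNat, reduceIte, Nat.reduceEqDiff, h_e9]
    linear_combination (-835/6*Y - 380/3*Y^3 + 80*Y^5 - 15*Y^7 - 185/6*X - 25/6*X*Y^2 + 55*X*Y^4 - 30*X*Y^6 -
      165/2*X^2*Y + 415/6*X^2*Y^3 - 1975/9*X^3 + 305/6*X^3*Y^2 - 15*X^3*Y^4 + 115*X^4*Y -
      15*X^4*Y^3 + 320/3*X^5 - 30*X^6*Y - 15*X^7 - 391/4*g*Y^2 - 359/28*g*Y^4 + 185/14*g*Y^6 -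
      75/4*g*Y^8 - 158*g*X*Y - 69/4*g*X*Y^3 - 163/28*g*X*Y^5 - 143/4*g*X^2 - 115*g*X^2*Y^2 +
      249/4*g*X^2*Y^4 - 555/28*g*X^2*Y^6 + 731/4*g*X^3*Y + 75*g*X^3*Y^3 - 75/4*g*X^3*Y^5 -
      4097/28*g*X^4 + 453/4*g*X^4*Y^2 - 513/28*g*X^5*Y - 75/4*g*X^5*Y^3 + 175/2*g*X^6 -
      555/28*g*X^6*Y^2 - 75/4*g*X^8 - 117*s*Y^2 + 85/2*s*Y^4 - 520/7*s*Y^6 - 200*s*X*Y -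
      225*s*X*Y^3 + 25/2*s*X*Y^5 + 121/3*s*X^2 - 50*s*X^2*Y^2 - 51*s*X^2*Y^4 + 175*s*X^3*Y -
      449/2*s*X^4 + 51*s*X^4*Y^2 - 25/2*s*X^5*Y + 520/7*s*X^6 + 155/12*s*g*Y - 145/12*s*g*Y^3 +
      4*s*g*Y^5 - 235/12*s*g*X - 101/12*s*g*X*Y^2 + 9*s*g*X*Y^4 + 181/12*s*g*X^2*Y -
      11/4*s*g*X^2*Y^3 + 63/4*s*g*X^3 + 11/4*s*g*X^3*Y^2 - 9*s*g*X^4*Y - 4*s*g*X^5 - 10/3*s^2*Y +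
      11/6*s^2*Y^3 - 10/3*s^2*X + 10/3*s^2*X*Y^2 + 10/3*s^2*X^2*Y + 11/6*s^2*X^3 + 53/4*s^2*g*Y^2
      + 273/20*s^2*g*Y^4 + 30*s^2*g*X*Y + 15/4*s^2*g*X*Y^3 - 7/4*s^2*g*X^2 + 15/2*s^2*g*X^2*Y^2 +
      15/4*s^2*g*X^3*Y + 273/20*s^2*g*X^4 + 5*s^3*Y^2 - 5*s^3*X^2) * hXY + (5/6*Y - 5/3*Y^3 -
      2*Y^5 + 7/8*Y^7 + 5/2*X - 5/3*X*Y^2 + 37/12*X*Y^4 + 5/2*X*Y^6 - 3/4*X*Y^8 + 5/3*X^2*Y +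
      14/3*X^2*Y^3 - 1/2*X^2*Y^5 - 2/9*X^3 + 5/2*X^3*Y^2 - 101/24*X^3*Y^4 - 85/18*X^4*Y -
      79/24*X^4*Y^3 + 3/4*X^4*Y^5 - 109/36*X^5 + 3/4*X^5*Y^4 + 23/6*X^6*Y + 19/24*X^7 - 3/4*X^8*Y
      - 5/2*s*Y^2 - 7/2*s*Y^4 + 27/4*s*Y^6 - 51/20*s*Y^8 - 4*s*X*Y - 15/2*s*X*Y^3 + 41/20*s*X*Y^5
      - 15/4*s*X*Y^7 - 1/2*s*X^2 + 5/2*s*X^2*Y^2 + 35/4*s*X^2*Y^4 + 27/2*s*X^3*Y + 5/2*s*X^3*Y^3 +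
      51/20*s*X^3*Y^5 + 47/3*s*X^4 - 15/4*s*X^4*Y^2 - 55/4*s*X^5*Y - 51/20*s*X^5*Y^3 -
      219/20*s*X^6 + 15/4*s*X^7*Y + 51/20*s*X^8) * hg
  · simp only [thL, evL, List.map_cons, List.map_nil, List.sum_cons, List.sum_nil,
      Nat.reduceAdd, Nat.cast_zero, Nat.cast_one, Nat.cast_ofNat, reduceIte, Nat.reduceEqDiff, h_e9]
    linear_combination (-185/3 + 3361/6*Y^2 - 1267/3*Y^4 - 775/3*Y^6 + 1010/9*Y^8 - 1055*X*Y + 1647/2*X*Y^3 -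
      135*X*Y^5 - 605/6*X*Y^7 + 4909/18*X^2 - 3485/3*X^2*Y^2 + 1747/2*X^2*Y^4 - 875/6*X^2*Y^8 +
      27499/18*X^3*Y + 15*X^3*Y^3 + 15*X^3*Y^5 - 3680/3*X^4 + 3501/2*X^4*Y^2 - 1960/3*X^5*Y -
      15*X^5*Y^3 + 850/3*X^6 - 875*X^6*Y^2 + 605/6*X^7*Y - 15*X^8 + 875/6*X^8*Y^2 - 25/3*g*Y -
      2851/28*g*Y^3 + 18325/336*g*Y^5 - 6351/56*g*Y^7 + 270/7*g*Y^9 + 112/3*g*X + 441/2*g*X*Y^2 -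
      2847/28*g*X*Y^4 - 753/112*g*X*Y^6 + 75/4*g*X*Y^8 - 107/3*g*X^2*Y - 166*g*X^2*Y^3 -
      2777/28*g*X^2*Y^5 + 2295/112*g*X^2*Y^7 + 50077/84*g*X^3 - 1154/3*g*X^3*Y^2 - 81*g*X^3*Y^4 +
      270/7*g*X^3*Y^6 + 869/84*g*X^4*Y + 207*g*X^4*Y^3 - 52919/112*g*X^5 + 11957/84*g*X^5*Y^2 +
      7673/112*g*X^6*Y - 270/7*g*X^6*Y^3 + 7041/28*g*X^7 - 2295/112*g*X^7*Y^2 - 75/4*g*X^8*Y -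
      270/7*g*X^9 + 1411/9*s*Y + 480*s*Y^3 - 16552/63*s*Y^5 + 7731/56*s*Y^7 + 437/3*s*X +
      2749/6*s*X*Y^2 - 151/3*s*X*Y^4 + 865/14*s*X*Y^6 - 631/6*s*X^2*Y - 634*s*X^2*Y^3 +
      259/6*s*X^2*Y^5 + 5078/9*s*X^3 - 1402/3*s*X^3*Y^2 + 126*s*X^3*Y^4 - 397/3*s*X^4*Y +
      126*s*X^4*Y^3 - 36110/63*s*X^5 + 259/6*s*X^5*Y^2 + 865/14*s*X^6*Y + 7731/56*s*X^7 + 37/2*s*g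
      + 12307/30*s*g*Y^2 + 1333/4*s*g*Y^4 - 365/4*s*g*Y^6 - 175/12*s*g*Y^8 + 983/2*s*g*X*Y -
      1907/20*s*g*X*Y^3 + 473/4*s*g*X*Y^5 - 553/30*s*g*X^2 + 1047/2*s*g*X^2*Y^2 -
      1311/10*s*g*X^2*Y^4 + 525/4*s*g*X^2*Y^6 - 36601/60*s*g*X^3*Y - 9/2*s*g*X^3*Y^3 -
      271/20*s*g*X^4 - 6561/10*s*g*X^4*Y^2 + 473/4*s*g*X^5*Y + 335/4*s*g*X^6 + 525/4*s*g*X^6*Y^2 -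
      175/12*s*g*X^8 + 6361/6*s^2*Y^2 - 891/10*s^2*Y^4 - 175/2*s^2*Y^6 + 525*s^2*X*Y +
      772/3*s^2*X*Y^3 + 5189/6*s^2*X^2 + 525*s^2*X^2*Y^2 + 525/2*s^2*X^2*Y^4 - 772/3*s^2*X^3*Y -
      4359/10*s^2*X^4 - 525/2*s^2*X^4*Y^2 + 175/2*s^2*X^6 - 335/6*s^2*g*Y - 371/60*s^2*g*Y^3 -
      1397/60*s^2*g*Y^5 - 325/6*s^2*g*X - 77/2*s^2*g*X*Y^2 - 123/20*s^2*g*X*Y^4 + 46*s^2*g*X^2*Y +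
      25/2*s^2*g*X^2*Y^3 - 1129/60*s^2*g*X^3 - 25/2*s^2*g*X^3*Y^2 + 123/20*s^2*g*X^4*Y +
      1397/60*s^2*g*X^5 - 110/3*s^3*Y - 25/3*s^3*Y^3 - 110/3*s^3*X + 5/2*s^3*X*Y^2 + 5/2*s^3*X^2*Y
      - 25/3*s^3*X^3 - 245/4*s^3*g*Y^2 + 105/4*s^3*g*Y^4 - 105/2*s^3*g*X*Y - 525/4*s^3*g*X^2 -
      105/2*s^3*g*X^2*Y^2 + 105/4*s^3*g*X^4 + 35/2*s^4*Y^2 - 35/2*s^4*X^2) * hXY + (-5/2*Y^2 -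
      167/2*Y^4 + 197/8*Y^6 + 1717/40*Y^8 - 175/24*Y^12 - 343/6*X*Y + 23/2*X*Y^3 + 971/30*X*Y^5 -
      27/8*X*Y^7 - 37/9*X*Y^9 + X^2 + 5/2*X^2*Y^2 + 9/2*X^2*Y^4 + 1/2*X^2*Y^6 + 361/4*X^3*Y +
      353/6*X^3*Y^3 - 1717/40*X^3*Y^5 + 175/24*X^3*Y^9 + 2105/36*X^4 - 15/4*X^4*Y^2 - 3/4*X^4*Y^4
      - 3/4*X^4*Y^6 - 19/2*X^5*Y - 3531/40*X^5*Y^3 - 17077/120*X^6 + 3/4*X^6*Y^4 + 37/8*X^7*Y +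
      175/4*X^7*Y^3 + 14093/120*X^8 - 3/4*X^9*Y - 175/24*X^9*Y^3 - 875/18*X^10 + 175/24*X^12 -
      4*s*Y + 7*s*Y^3 + 1751/120*s*Y^5 - 35/2*s*Y^7 + 259/120*s*Y^9 - 8*s*X + 451/36*s*X*Y^2 -
      53/3*s*X*Y^4 - 1631/180*s*X*Y^6 + 63/10*s*X*Y^8 - 4*s*X^2*Y - 1259/24*s*X^2*Y^3 +
      21/5*s*X^2*Y^5 - 599/36*s*X^3 - 451/24*s*X^3*Y^2 + 38*s*X^3*Y^4 - 259/120*s*X^3*Y^6 +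
      59/3*s*X^4*Y + 89/3*s*X^4*Y^3 - 63/10*s*X^4*Y^5 + 19453/360*s*X^5 - 63/10*s*X^5*Y^4 -
      247/10*s*X^6*Y - 259/120*s*X^6*Y^3 - 3709/180*s*X^7 + 63/10*s*X^8*Y + 259/120*s*X^9 +
      315/8*s^2*Y^4 + 105/8*s^2*Y^8 + 105/4*s^2*X*Y - 315/8*s^2*X*Y^3 + 35/4*s^2*X*Y^5 -
      105/4*s^2*X^2 - 315/8*s^2*X^3*Y - 105/4*s^2*X^3*Y^3 - 105/8*s^2*X^3*Y^5 + 175/8*s^2*X^4 +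
      105/8*s^2*X^5*Y^3 + 35*s^2*X^6 - 105/8*s^2*X^8) * hg

noncomputable def h_e10 (g : ℂ) : ℕ → List (ℂ × ℕ × ℕ)
  | 0 => []
  | 1 => [(1, 0, 0)]
  | 2 => []
  | 3 => [(1/2*g, 0, 3), (-1/2*g, 0, 1), (-1/2*g, 1, 0), (1/2*g, 3, 0)]
  | 4 => [(-3/8*g, 0, 4), (g, 0, 2), (-g, 2, 0), (3/8*g, 4, 0)]
  | 5 => [(-5/2, 0, 6), (3/10*g, 0, 5), (5, 0, 4), (-7/6*g, 0, 3), (5/2, 0, 2), (g, 0, 1), (g, 1, 0),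
      (5/2, 2, 0), (-7/6*g, 3, 0), (5, 4, 0), (3/10*g, 5, 0), (-5/2, 6, 0)]
  | 6 => [(30/7, 0, 7), (-1/4*g, 0, 6), (-16, 0, 5), (5/4*g, 0, 4), (70/9, 0, 3), (-7/4*g, 0, 2),
      (80/3, 0, 1), (-80/3, 1, 0), (7/4*g, 2, 0), (-70/9, 3, 0), (-5/4*g, 4, 0), (16, 5, 0),
      (1/4*g, 6, 0), (-30/7, 7, 0)]
  | 7 => [(-25/12*g, 0, 9), (-45/8, 0, 8), (181/28*g, 0, 7), (260/9, 0, 6), (-13/10*g, 0, 5), (-355/9,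
      0, 4), (65/6*g, 0, 3), (-220/9, 0, 2), (-13*g, 0, 1), (-13*g, 1, 0), (-220/9, 2, 0),
      (65/6*g, 3, 0), (-355/9, 4, 0), (-13/10*g, 5, 0), (260/9, 6, 0), (181/28*g, 7, 0), (-45/8,
      8, 0), (-25/12*g, 9, 0)]
  | 8 => [(321/56*g, 0, 10), (20/3, 0, 9), (-773/28*g, 0, 8), (-895/21, 0, 7), (4763/168*g, 0, 6),
      (785/9, 0, 5), (2459/84*g, 0, 4), (-235/9, 0, 3), (-148/3*g, 0, 2), (-1115/9, 0, 1),
      (1115/9, 1, 0), (148/3*g, 2, 0), (235/9, 3, 0), (-2459/84*g, 4, 0), (-785/9, 5, 0),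
      (-4763/168*g, 6, 0), (895/21, 7, 0), (773/28*g, 8, 0), (-20/3, 9, 0), (-321/56*g, 10, 0)]
  | 9 => [(875/72, 0, 12), (-1185/112*g, 0, 11), (-505/9, 0, 10), (202003/3024*g, 0, 9), (5839/72, 0,
      8), (-127831/1008*g, 0, 7), (-8009/27, 0, 6), (-2683/336*g, 0, 5), (3949/8, 0, 4),
      (-1594/63*g, 0, 3), (282, 0, 2), (1222/9*g, 0, 1), (1222/9*g, 1, 0), (282, 2, 0),
      (-1594/63*g, 3, 0), (3949/8, 4, 0), (-2683/336*g, 5, 0), (-8009/27, 6, 0), (-127831/1008*g,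
      7, 0), (5839/72, 8, 0), (202003/3024*g, 9, 0), (-505/9, 10, 0), (-1185/112*g, 11, 0),
      (875/72, 12, 0)]
  | 10 => [(-25385/546, 0, 13), (21995/1344*g, 0, 12), (386615/1386, 0, 11), (-35159/280*g, 0, 10),
      (-89666/189, 0, 9), (334547/1008*g, 0, 8), (15262/63, 0, 7), (-349159/1512*g, 0, 6),
      (-4775/14, 0, 5), (-968389/4032*g, 0, 4), (26701/126, 0, 3), (22049/126*g, 0, 2), (71632/63,
      0, 1), (-71632/63, 1, 0), (-22049/126*g, 2, 0), (-26701/126, 3, 0), (968389/4032*g, 4, 0),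
      (4775/14, 5, 0), (349159/1512*g, 6, 0), (-15262/63, 7, 0), (-334547/1008*g, 8, 0),
      (89666/189, 9, 0), (35159/280*g, 10, 0), (-386615/1386, 11, 0), (-21995/1344*g, 12, 0),
      (25385/546, 13, 0)]
  | _ => []

theorem e10 (l g : ℂ) (hl : l ≠ 0) (hg : 3 * g ^ 2 + 20 = 0) (H : Fam l (1) (1) (1/2*g) (-1/2*g) (-3/2*g) (3/2*g) (g)) :
    2089/9*g = 0 := by
  refine lyap hl H (h_e10 g) 7 _ rfl rfl rfl ?_
  intro X Y hXY m hm
  interval_cases m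
  · simp only [thL, evL, List.map_cons, List.map_nil, List.sum_cons, List.sum_nil,
      Nat.reduceAdd, Nat.cast_zero, Nat.cast_one, Nat.cast_ofNat, reduceIte, Nat.reduceEqDiff, h_e10]
    linear_combination (0) * hXY + (0) * hg
  · simp only [thL, evL, List.map_cons, List.map_nil, List.sum_cons, List.sum_nil,
      Nat.reduceAdd, Nat.cast_zero, Nat.cast_one, Nat.cast_ofNat, reduceIte, Nat.reduceEqDiff, h_e10]
    linear_combination (-g + 3/2*g*Y^2 + 3/2*g*X^2) * hXY + (0) * hg
  · simp only [thL, evL, List.map_cons, List.map_nil, List.sum_cons, List.sum_nil,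
      Nat.reduceAdd, Nat.cast_zero, Nat.cast_one, Nat.cast_ofNat, reduceIte, Nat.reduceEqDiff, h_e10]
    linear_combination (10*Y^2 - 10*X^2 + g*Y - g*X - 3/2*g*X*Y^2 + 3/2*g*X^2*Y) * hXY + (1/4*Y^2 - Y^4 + 3/4*Y^6 -
      1/2*X*Y^3 - 1/4*X^2 + 1/2*X^3*Y + X^4 - 3/4*X^6) * hg
  · simp only [thL, evL, List.map_cons, List.map_nil, List.sum_cons, List.sum_nil,
      Nat.reduceAdd, Nat.cast_zero, Nat.cast_one, Nat.cast_ofNat, reduceIte, Nat.reduceEqDiff, h_e10]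
    linear_combination (50/3*Y + 35*Y^3 - 15*Y^5 + 50/3*X + 15*X*Y^2 + 15*X^2*Y - 15*X^2*Y^3 + 35*X^3 - 15*X^3*Y^2
      - 15*X^5 - 3/2*g*Y^2 - 4*g*X*Y + 3/2*g*X*Y^3 - 3/2*g*X^2 + 3/2*g*X^3*Y) * hXY + (-1/2*Y +
      1/12*Y^3 + 5/4*Y^5 - 1/2*X + 5/12*X*Y^2 + 1/4*X*Y^4 - 3/4*X*Y^6 + 5/12*X^2*Y - 3/2*X^2*Y^3 +
      1/12*X^3 - 3/2*X^3*Y^2 + 3/4*X^3*Y^4 + 1/4*X^4*Y + 3/4*X^4*Y^3 + 5/4*X^5 - 3/4*X^6*Y) * hg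
  · simp only [thL, evL, List.map_cons, List.map_nil, List.sum_cons, List.sum_nil,
      Nat.reduceAdd, Nat.cast_zero, Nat.cast_one, Nat.cast_ofNat, reduceIte, Nat.reduceEqDiff, h_e10]
    linear_combination (130/9*Y^2 - 60*Y^4 + 15*Y^6 + 15*X*Y^3 + 15*X*Y^5 - 130/9*X^2 - 15*X^3*Y + 60*X^4 -
      15*X^5*Y - 15*X^6 - 13*g*Y + 131/4*g*Y^3 - 25/4*g*Y^5 + 13*g*X - 61/4*g*X*Y^2 + 69/4*g*X*Y^4
      + 61/4*g*X^2*Y - 75/2*g*X^2*Y^3 + 75/4*g*X^2*Y^5 - 131/4*g*X^3 + 75/2*g*X^3*Y^2 -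
      69/4*g*X^4*Y + 25/4*g*X^5 - 75/4*g*X^5*Y^2) * hXY + (1/2*Y^2 + 83/36*Y^4 - 11/12*Y^6 +
      103/36*X*Y^3 - 9/4*X*Y^5 + 3/4*X*Y^7 - 1/2*X^2 - 7/4*X^2*Y^4 - 103/36*X^3*Y - 83/36*X^4 +
      7/4*X^4*Y^2 + 9/4*X^5*Y + 11/12*X^6 - 3/4*X^7*Y) * hg
  · simp only [thL, evL, List.map_cons, List.map_nil, List.sum_cons, List.sum_nil,
      Nat.reduceAdd, Nat.cast_zero, Nat.cast_one, Nat.cast_ofNat, reduceIte, Nat.reduceEqDiff, h_e10]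
    linear_combination (-815/9*Y - 170*Y^3 + 280/3*Y^5 - 15*Y^7 - 815/9*X - 340/9*X*Y^2 + 85*X*Y^4 - 30*X*Y^6 -
      340/9*X^2*Y + 60*X^2*Y^3 - 170*X^3 + 60*X^3*Y^2 - 15*X^3*Y^4 + 85*X^4*Y - 15*X^4*Y^3 +
      280/3*X^5 - 30*X^6*Y - 15*X^7 - 343/6*g*Y^2 - 1591/28*g*Y^4 + 705/14*g*Y^6 - 75/4*g*Y^8 -
      108*g*X*Y + 89*g*X*Y^3 - 169/14*g*X*Y^5 - 343/6*g*X^2 - 205/2*g*X^2*Y^2 + 351/4*g*X^2*Y^4 -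
      555/28*g*X^2*Y^6 + 89*g*X^3*Y + 75*g*X^3*Y^3 - 75/4*g*X^3*Y^5 - 1591/28*g*X^4 +
      351/4*g*X^4*Y^2 - 169/14*g*X^5*Y - 75/4*g*X^5*Y^3 + 705/14*g*X^6 - 555/28*g*X^6*Y^2 -
      75/4*g*X^8) * hXY + (5/3*Y - 37/36*Y^3 - 91/36*Y^5 + 5/6*Y^7 + 5/3*X - 11/12*X*Y^2 -
      25/36*X*Y^4 + 19/6*X*Y^6 - 3/4*X*Y^8 - 11/12*X^2*Y + 67/18*X^2*Y^3 - 1/4*X^2*Y^5 - 37/36*X^3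
      + 67/18*X^3*Y^2 - 15/4*X^3*Y^4 - 25/36*X^4*Y - 15/4*X^4*Y^3 + 3/4*X^4*Y^5 - 91/36*X^5 -
      1/4*X^5*Y^2 + 3/4*X^5*Y^4 + 19/6*X^6*Y + 5/6*X^7 - 3/4*X^8*Y) * hg
  · simp only [thL, evL, List.map_cons, List.map_nil, List.sum_cons, List.sum_nil,
      Nat.reduceAdd, Nat.cast_zero, Nat.cast_one, Nat.cast_ofNat, reduceIte, Nat.reduceEqDiff, h_e10]
    linear_combination (4946/9*Y^2 + 4147/6*Y^4 - 1250/3*Y^6 + 1145/18*Y^8 + 691/9*X*Y^3 + 1555/6*X*Y^5 -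
      605/6*X*Y^7 - 4946/9*X^2 - X^2*Y^4 + 875/2*X^2*Y^6 - 875/6*X^2*Y^8 - 691/9*X^3*Y +
      15*X^3*Y^5 - 4147/6*X^4 + X^4*Y^2 - 1555/6*X^5*Y - 15*X^5*Y^3 + 1250/3*X^6 - 875/2*X^6*Y^2 +
      605/6*X^7*Y - 1145/18*X^8 + 875/6*X^8*Y^2 - 218/9*g*Y - 21323/63*g*Y^3 + 226507/1008*g*Y^5 -
      2919/16*g*Y^7 + 270/7*g*Y^9 + 218/9*g*X + 173/3*g*X*Y^2 - 2783/42*g*X*Y^4 - 4213/112*g*X*Y^6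
      + 75/4*g*X*Y^8 - 173/3*g*X^2*Y + 781/6*g*X^2*Y^3 - 2536/21*g*X^2*Y^5 + 2295/112*g*X^2*Y^7 +
      21323/63*g*X^3 - 781/6*g*X^3*Y^2 - 144*g*X^3*Y^4 + 270/7*g*X^3*Y^6 + 2783/42*g*X^4*Y +
      144*g*X^4*Y^3 - 226507/1008*g*X^5 + 2536/21*g*X^5*Y^2 + 4213/112*g*X^6*Y - 270/7*g*X^6*Y^3 +
      2919/16*g*X^7 - 2295/112*g*X^7*Y^2 - 75/4*g*X^8*Y - 270/7*g*X^9) * hXY + (35/3*Y^2 -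
      485/9*Y^4 + 973/30*Y^6 - 971/120*Y^8 + 875/36*Y^10 - 175/24*Y^12 - 1309/36*X*Y^3 +
      187/30*X*Y^5 + 79/24*X*Y^7 - 121/72*X*Y^9 - 35/3*X^2 + 4*X^2*Y^4 + 1/4*X^2*Y^6 +
      1309/36*X^3*Y + 4/5*X^3*Y^5 - 175/8*X^3*Y^7 + 175/24*X^3*Y^9 + 485/9*X^4 - 4*X^4*Y^2 -
      3/4*X^4*Y^6 - 187/30*X^5*Y - 4/5*X^5*Y^3 - 973/30*X^6 - 1/4*X^6*Y^2 + 3/4*X^6*Y^4 -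
      79/24*X^7*Y + 175/8*X^7*Y^3 + 971/120*X^8 + 121/72*X^9*Y - 175/24*X^9*Y^3 - 875/36*X^10 +
      175/24*X^12) * hg
  · simp only [thL, evL, List.map_cons, List.map_nil, List.sum_cons, List.sum_nil,
      Nat.reduceAdd, Nat.cast_zero, Nat.cast_one, Nat.cast_ofNat, reduceIte, Nat.reduceEqDiff, h_e10]
    linear_combination (33412/63*Y + 474301/126*Y^3 - 476965/126*Y^5 + 78658/63*Y^7 - 8475/14*Y^9 + 875/6*Y^11 +
      33412/63*X - 131837/63*X*Y^2 + 158527/126*X*Y^4 - 16255/14*X*Y^6 + 12860/63*X*Y^8 -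
      131837/63*X^2*Y + 51091/21*X^2*Y^3 + 72433/42*X^2*Y^5 - 33815/21*X^2*Y^7 + 13135/42*X^2*Y^9
      + 474301/126*X^3 + 51091/21*X^3*Y^2 + 91*X^3*Y^4 - 905/2*X^3*Y^6 + 875/6*X^3*Y^8 +
      158527/126*X^4*Y + 91*X^4*Y^3 - 476965/126*X^5 + 72433/42*X^5*Y^2 - 16255/14*X^6*Y -
      905/2*X^6*Y^3 + 78658/63*X^7 - 33815/21*X^7*Y^2 + 12860/63*X^8*Y + 875/6*X^8*Y^3 -
      8475/14*X^9 + 13135/42*X^9*Y^2 + 875/6*X^11 + 2089/9*g + 6239/21*g*Y^2 + 40499/112*g*Y^4 -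
      43103/56*g*Y^6 + 10845/28*g*Y^8 - 945/16*g*Y^10 + 6121/9*g*X*Y - 35587/63*g*X*Y^3 -
      123163/1008*g*X*Y^5 + 6149/28*g*X*Y^7 - 1605/28*g*X*Y^9 + 6239/21*g*X^2 + 935/3*g*X^2*Y^2 -
      1975/6*g*X^2*Y^4 + 50075/336*g*X^2*Y^6 - 335/16*g*X^2*Y^8 - 35587/63*g*X^3*Y -
      2485/3*g*X^3*Y^3 + 910/3*g*X^3*Y^5 - 945/16*g*X^3*Y^7 + 40499/112*g*X^4 - 1975/6*g*X^4*Y^2 -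
      123163/1008*g*X^5*Y + 910/3*g*X^5*Y^3 - 43103/56*g*X^6 + 50075/336*g*X^6*Y^2 +
      6149/28*g*X^7*Y - 945/16*g*X^7*Y^3 + 10845/28*g*X^8 - 335/16*g*X^8*Y^2 - 1605/28*g*X^9*Y -
      945/16*g*X^10) * hXY + (-91/3*Y + 956/9*Y^3 - 374897/1260*Y^5 + 168601/1260*Y^7 +
      335819/2520*Y^9 - 5860/63*Y^11 + 2627/168*Y^13 - 91/3*X - 1457/18*X*Y^2 + 2701/42*X*Y^4 -
      3967/1260*X*Y^6 - 3607/210*X*Y^8 - 10001/504*X*Y^10 + 175/24*X*Y^12 - 1457/18*X^2*Y +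
      8287/36*X^2*Y^3 + 91/60*X^2*Y^5 - 181/24*X^2*Y^7 + 175/72*X^2*Y^9 + 956/9*X^3 +
      8287/36*X^3*Y^2 - 2459/21*X^3*Y^4 - 45719/420*X^3*Y^6 + 4917/56*X^3*Y^8 - 2627/168*X^3*Y^10
      + 2701/42*X^4*Y - 2459/21*X^4*Y^3 - 91/20*X^4*Y^5 + 181/8*X^4*Y^7 - 175/24*X^4*Y^9 -
      374897/1260*X^5 + 91/60*X^5*Y^2 - 91/20*X^5*Y^4 - 3967/1260*X^6*Y - 45719/420*X^6*Y^3 +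
      168601/1260*X^7 - 181/24*X^7*Y^2 + 181/8*X^7*Y^4 - 3607/210*X^8*Y + 4917/56*X^8*Y^3 +
      335819/2520*X^9 + 175/72*X^9*Y^2 - 175/24*X^9*Y^4 - 10001/504*X^10*Y - 2627/168*X^10*Y^3 -
      5860/63*X^11 + 175/24*X^12*Y + 2627/168*X^13) * hg

theorem fam_of_center {l p q r s u v g : ℂ} (F : ℝ → ℂ → ℂ)
    (hF : ∀ t z, F t z = I * ((p * Xf l t + q * Yf l t) * z ^ 2 +
      (r * Xf l t + s * Yf l t + u * Xf l t ^ 3 + v * Yf l t ^ 3) * z ^ 3 + g * z ^ 4))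
    (hc : IsCenter (2 * Real.pi) F) : Fam l p q r s u v g := by
  obtain ⟨ε, hε, H⟩ := hc
  have cX := Xf_cont l
  have cY := Yf_cont l
  have hpi := Real.pi_pos
  obtain ⟨B, hB0, hB⟩ : ∃ B > (0 : ℝ), ∀ t ∈ Set.Icc (0 : ℝ) (2 * Real.pi), ∀ z : ℂ, ‖z‖ ≤ 1 →
      ‖F t z‖ ≤ B * ‖z‖ ^ 2 := by
    obtain ⟨B, hB⟩ := IsCompact.exists_bound_of_continuousOn
      (f := fun x : ℝ × ℂ => I * ((p * Xf l x.1 + q * Yf l x.1) +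
      (r * Xf l x.1 + s * Yf l x.1 + u * Xf l x.1 ^ 3 + v * Yf l x.1 ^ 3) * x.2 + g * x.2 ^ 2))
      ((isCompact_Icc (a := (0 : ℝ)) (b := 2 * Real.pi)).prod
        (isCompact_closedBall (0 : ℂ) 1)) (Continuous.continuousOn (by fun_prop))
    refine ⟨|B| + 1, by positivity, fun t ht z hz => ?_⟩
    have h1 := hB (t, z) ⟨ht, by simpa using hz⟩
    rw [hF]
    have : I * ((p * Xf l t + q * Yf l t) * z ^ 2 +
      (r * Xf l t + s * Yf l t + u * Xf l t ^ 3 + v * Yf l t ^ 3) * z ^ 3 + g * z ^ 4) =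
      (I * ((p * Xf l t + q * Yf l t) +
      (r * Xf l t + s * Yf l t + u * Xf l t ^ 3 + v * Yf l t ^ 3) * z + g * z ^ 2)) * z ^ 2 := by
      ring
    rw [this, norm_mul, norm_pow]
    gcongr
    exact h1.trans (by linarith [le_abs_self B])
  obtain ⟨MA, hM0, hM⟩ : ∃ MA > (0 : ℝ), ∀ t ∈ Set.Icc (0 : ℝ) (2 * Real.pi),
      ‖p * Xf l t - q * Yf l t‖ ≤ MA := by
    obtain ⟨B, hB⟩ := IsCompact.exists_bound_of_continuousOn
      (f := fun t : ℝ => p * Xf l t - q * Yf l t)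
      (isCompact_Icc (a := (0 : ℝ)) (b := 2 * Real.pi)) (Continuous.continuousOn (by fun_prop))
    exact ⟨|B| + 1, by positivity, fun t ht => (hB t ht).trans (by linarith [le_abs_self B])⟩
  refine ⟨2 * (4 * B * (2 * Real.pi) + 2 * MA), min (min ε (1 / 2)) (min (1 / (8 * Real.pi * B))
    (1 / (4 * MA))), by positivity, ?_⟩
  intro c hc0 hcs
  simp only [lt_min_iff] at hcs
  obtain ⟨⟨hcε, hc2⟩, hcB, hcM⟩ := hcs
  rw [lt_div_iff₀ (by positivity)] at hcB hcM
  obtain ⟨z, hz, hz0, hz1⟩ := H c hcε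
  -- a priori bound
  have hb0 : ∀ t ∈ Set.Icc (0 : ℝ) (2 * Real.pi), ‖z t‖ ≤ ‖c‖ + ‖c‖ / (2 * Real.pi) * t := by
    intro t ht
    refine image_norm_le_of_norm_deriv_right_lt_deriv_boundary (a := 0) (b := 2 * Real.pi)
      (f := z) (f' := fun t => F t (z t)) (B := fun t => ‖c‖ + ‖c‖ / (2 * Real.pi) * t)
      (B' := fun _ => ‖c‖ / (2 * Real.pi)) ?_ ?_ ?_ ?_ ?_ ht
    · exact fun t ht => (hz t ht).continuousAt.continuousWithinAt
    · exact fun t ht => (hz t (Set.Ico_subset_Icc_self ht)).hasDerivWithinAt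
    · simp [hz0]
    · intro x
      simpa using ((hasDerivAt_id x).const_mul (‖c‖ / (2 * Real.pi))).const_add ‖c‖
    · intro x hx hxe
      have h1 : ‖z x‖ ≤ 2 * ‖c‖ := by
        rw [hxe]
        have : ‖c‖ / (2 * Real.pi) * x ≤ ‖c‖ / (2 * Real.pi) * (2 * Real.pi) := by
          gcongr; exact hx.2.le
        have e : ‖c‖ / (2 * Real.pi) * (2 * Real.pi) = ‖c‖ := by field_simp
        linarith
      have h2 := hB x (Set.Ico_subset_Icc_self hx) (z x) (by linarith)
      refine lt_of_le_of_lt h2 ?_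
      rw [lt_div_iff₀ (by positivity)]
      have h3 : ‖z x‖ ^ 2 ≤ (2 * ‖c‖) ^ 2 := by gcongr
      calc B * ‖z x‖ ^ 2 * (2 * Real.pi) ≤ B * (2 * ‖c‖) ^ 2 * (2 * Real.pi) := by gcongr
        _ = (‖c‖ * (8 * Real.pi * B)) * ‖c‖ := by ring
        _ < 1 * ‖c‖ := by gcongr
        _ = ‖c‖ := one_mul _
  have hb : ∀ t ∈ Set.Icc (0 : ℝ) (2 * Real.pi), ‖z t‖ ≤ 2 * ‖c‖ := by
    intro t ht
    have h1 := hb0 t ht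
    have : ‖c‖ / (2 * Real.pi) * t ≤ ‖c‖ / (2 * Real.pi) * (2 * Real.pi) := by
      gcongr; exact ht.2
    have e : ‖c‖ / (2 * Real.pi) * (2 * Real.pi) = ‖c‖ := by field_simp
    linarith
  have hzc : ∀ t ∈ Set.Icc (0 : ℝ) (2 * Real.pi),
      ‖z t - c‖ ≤ 4 * B * (2 * Real.pi) * ‖c‖ ^ 2 := by
    intro t ht
    have h1 := Convex.norm_image_sub_le_of_norm_hasDerivWithin_le (f := z)
      (f' := fun t => F t (z t)) (s := Set.Icc (0 : ℝ) (2 * Real.pi)) (C := 4 * B * ‖c‖ ^ 2)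
      (fun t ht => (hz t ht).hasDerivWithinAt) (fun t ht => by
        have h2 := hB t ht (z t) (by linarith [hb t ht])
        have h3 : ‖z t‖ ^ 2 ≤ (2 * ‖c‖) ^ 2 := by
          have := hb t ht
          gcongr
        calc ‖F t (z t)‖ ≤ B * ‖z t‖ ^ 2 := h2
          _ ≤ B * (2 * ‖c‖) ^ 2 := by gcongr
          _ = _ := by ring) (convex_Icc _ _)
      (Set.left_mem_Icc.2 (by positivity)) ht
    rw [hz0, sub_zero, Real.norm_of_nonneg ht.1] at h1
    calc ‖z t - c‖ ≤ 4 * B * ‖c‖ ^ 2 * t := h1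
      _ ≤ 4 * B * ‖c‖ ^ 2 * (2 * Real.pi) := by gcongr; exact ht.2
      _ = _ := by ring
  refine ⟨fun t => z t / (1 + (p * Xf l t - q * Yf l t) * z t), ?_, ?_⟩
  · simp only [Xf_per, Yf_per, hz0, hz1]
  intro t ht
  have hAz : ‖(p * Xf l t - q * Yf l t) * z t‖ ≤ 1 / 2 := by
    rw [norm_mul]
    calc _ ≤ MA * (2 * ‖c‖) := mul_le_mul (hM t ht) (hb t ht) (norm_nonneg _) hM0.le
      _ ≤ 1 / 2 := by linarith
  have hn : 1 / 2 ≤ ‖1 + (p * Xf l t - q * Yf l t) * z t‖ := by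
    have := norm_sub_norm_le (1 : ℂ) (-((p * Xf l t - q * Yf l t) * z t))
    rw [norm_neg, norm_one, sub_neg_eq_add] at this
    linarith
  have hne : 1 + (p * Xf l t - q * Yf l t) * z t ≠ 0 := by
    intro h0; rw [h0, norm_zero] at hn; linarith
  have hinv : 1 - (p * Xf l t - q * Yf l t) * (z t / (1 + (p * Xf l t - q * Yf l t) * z t)) =
      1 / (1 + (p * Xf l t - q * Yf l t) * z t) := by
    field_simp
    ring
  refine ⟨?_, ?_, ?_⟩
  · have e : z t / (1 + (p * Xf l t - q * Yf l t) * z t) - c =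
        (z t - c - c * ((p * Xf l t - q * Yf l t) * z t)) /
          (1 + (p * Xf l t - q * Yf l t) * z t) := by
      rw [eq_div_iff hne, sub_mul, div_mul_cancel₀ _ hne]
      ring
    rw [e, norm_div, div_le_iff₀ (by linarith)]
    have h1 : ‖z t - c - c * ((p * Xf l t - q * Yf l t) * z t)‖ ≤
        4 * B * (2 * Real.pi) * ‖c‖ ^ 2 + 2 * MA * ‖c‖ ^ 2 := by
      refine (norm_sub_le _ _).trans (add_le_add (hzc t ht) ?_)
      rw [norm_mul, norm_mul]
      calc _ ≤ ‖c‖ * (MA * (2 * ‖c‖)) := by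
            gcongr
            · exact hM t ht
            · exact hb t ht
        _ = _ := by ring
    refine h1.trans ?_
    have h2 : 0 ≤ 2 * (4 * B * (2 * Real.pi) + 2 * MA) * ‖c‖ ^ 2 := by positivity
    nlinarith [mul_le_mul_of_nonneg_left hn h2]
  · rw [hinv]
    exact one_div_ne_zero hne
  · have hA : HasDerivAt (fun t => p * Xf l t - q * Yf l t)
        (p * (I * Xf l t) - q * (-(I * Yf l t))) t :=
      ((Xf_deriv l t).const_mul p).sub ((Yf_deriv l t).const_mul q)
    have hd := (hz t ht).div ((hA.mul (hz t ht)).const_add 1) hne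
    refine hd.congr_deriv ?_
    simp only [Pi.mul_apply]
    rw [hinv, hF]
    generalize Xf l t = X at *
    generalize Yf l t = Y at *
    field_simp
    ring

theorem center_scale {ω : ℝ} {F : ℝ → ℂ → ℂ} (μ : ℂ) (hμ : μ ≠ 0) (h : IsCenter ω F) :
    IsCenter ω (fun t z => μ * F t (z / μ)) := by
  obtain ⟨ε, hε, H⟩ := h
  have hm : 0 < ‖μ‖ := norm_pos_iff.2 hμ
  refine ⟨ε * ‖μ‖, by positivity, fun c hc => ?_⟩
  obtain ⟨z, hz, h0, h1⟩ := H (c / μ) (by rw [norm_div, div_lt_iff₀ hm]; exact hc)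
  refine ⟨fun t => μ * z t, fun t ht => ?_, ?_, ?_⟩
  · refine ((hz t ht).const_mul μ).congr_deriv ?_
    simp only
    rw [mul_div_cancel_left₀ _ hμ]
  · simp only [h0]; field_simp
  · simp only [h1]; field_simp

theorem fam_one {l r s u v g : ℂ} (hl : l ≠ 0) (hg : g ≠ 0) (H : Fam l 1 1 r s u v g) : False := by
  have a4 := e4 l 1 1 r s u v g hl H
  obtain rfl : r = g + s := by linear_combination -a4
  have a6 := e6 l s u v g hl H
  obtain rfl : v = 3*g + u := by linear_combination a6
  have a7 := e7 l s u g hl H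
  obtain rfl : u = -3/2*g := by
    apply mul_left_cancel₀ hg
    linear_combination 3/4 * a7
  have h32 : 3*g + -3/2*g = 3/2*g := by ring
  rw [h32] at H
  have a8 := e8 l s g hl H
  have hg2 : 3 * g ^ 2 + 20 = 0 := by
    apply mul_left_cancel₀ hg
    linear_combination 4 * a8
  have a9 := e9 l s g hl hg2 H
  obtain rfl : s = -1/2*g := by
    apply mul_left_cancel₀ hg
    linear_combination 2/37 * a9 + 1/6 * hg2
  have h12 : g + -1/2*g = 1/2*g := by ring
  rw [h12] at H
  have a10 := e10 l g hl hg2 H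
  apply hg
  linear_combination 9/2089 * a10

theorem main_false {p q r s u v g : ℂ} (hg : g ≠ 0) (F : ℝ → ℂ → ℂ)
    (hF : ∀ t z, F t z = I * ((p * Xf 1 t + q * Yf 1 t) * z ^ 2 +
      (r * Xf 1 t + s * Yf 1 t + u * Xf 1 t ^ 3 + v * Yf 1 t ^ 3) * z ^ 3 + g * z ^ 4))
    (hc : IsCenter (2 * Real.pi) F) : False := by
  have H := fam_of_center F hF hc
  have a4 := e4 1 p q r s u v g one_ne_zero H
  by_cases hp : p = 0
  · subst hp
    obtain rfl : g = q * r := by linear_combination a4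
    have hq : q ≠ 0 := left_ne_zero_of_mul hg
    have a6 := eq6 1 q r s u v one_ne_zero H
    obtain rfl : u = 0 := by
      have : q ^ 3 * u = 0 := by linear_combination -a6
      exact (mul_eq_zero.1 this).resolve_left (pow_ne_zero _ hq)
    have a7 := eq7 1 q r s v one_ne_zero H
    have : (q * r) ^ 2 = 0 := by linear_combination -1/2 * a7
    exact hg (pow_eq_zero_iff (two_ne_zero) |>.1 this)
  by_cases hq : q = 0
  · subst hq
    obtain rfl : g = -p * s := by linear_combination a4
    have a6 := ep6 1 p r s u v one_ne_zero H
    obtain rfl : v = 0 := by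
      exact (mul_eq_zero.1 a6).resolve_left (pow_ne_zero _ hp)
    have a7 := ep7 1 p r s u one_ne_zero H
    have : (-p * s) ^ 2 = 0 := by linear_combination 1/2 * a7
    exact hg (pow_eq_zero_iff (two_ne_zero) |>.1 this)
  obtain ⟨l, hl2⟩ := IsAlgClosed.exists_pow_nat_eq (p / q) (n := 2) (by norm_num)
  have hl : l ≠ 0 := by
    rintro rfl
    have : p / q ≠ 0 := div_ne_zero hp hq
    apply this
    rw [← hl2]; norm_num
  have hp2 : p = l ^ 2 * q := by rw [hl2]; field_simp
  have hμ : q * l ≠ 0 := mul_ne_zero hq hl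
  refine fam_one (l := l) (r := r / l / (q * l) ^ 2) (s := s * l / (q * l) ^ 2)
    (u := u / l ^ 3 / (q * l) ^ 2) (v := v * l ^ 3 / (q * l) ^ 2) (g := g / (q * l) ^ 3) hl
    (div_ne_zero hg (pow_ne_zero _ hμ))
    (fam_of_center _ ?_ (center_scale (q * l) hμ hc))
  intro t z
  have hX : Xf 1 t = Xf l t / l := by unfold Xf; field_simp
  have hY : Yf 1 t = Yf l t * l := by unfold Yf; field_simp
  rw [hF, hX, hY, hp2]
  generalize Xf l t = X
  generalize Yf l t = Y
  field_simp

theorem stmt_19 (a b c d e f : ℂ) :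
    ¬ IsCenter (2 * Real.pi) (fun t z =>
      z ^ 4 + (c * (Real.cos t : ℂ) + d * (Real.sin t : ℂ) +
          e * (Real.cos t : ℂ) * (Real.sin t : ℂ) ^ 2 +
          f * (Real.sin t : ℂ) * (Real.cos t : ℂ) ^ 2) * z ^ 3 +
        (a * (Real.cos t : ℂ) + b * (Real.sin t : ℂ)) * z ^ 2) := by
  intro h
  refine main_false (p := -I * (a - I * b) / 2) (q := -I * (a + I * b) / 2)
    (r := -I * (c / 2 - I * d / 2 + e / 8 - I * f / 8))
    (s := -I * (c / 2 + I * d / 2 + e / 8 + I * f / 8))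
    (u := -I * (-e / 8 - I * f / 8)) (v := -I * (-e / 8 + I * f / 8))
    (g := -I) (by simp) _ ?_ h
  intro t z
  have hX : Xf 1 t = (Real.cos t : ℂ) + (Real.sin t : ℂ) * I := by
    unfold Xf
    rw [one_mul, mul_comm, exp_mul_I, ofReal_cos, ofReal_sin]
  have hY : Yf 1 t = (Real.cos t : ℂ) - (Real.sin t : ℂ) * I := by
    unfold Yf
    rw [inv_one, one_mul, mul_comm, ← neg_mul, exp_mul_I, ofReal_cos, ofReal_sin, cos_neg, sin_neg]
    ring
  have hcs : (Real.cos t : ℂ) ^ 2 + (Real.sin t : ℂ) ^ 2 = 1 := by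
    rw [← ofReal_pow, ← ofReal_pow, ← ofReal_add]; simp
  rw [hX, hY]
  generalize (Real.cos t : ℂ) = C at *
  generalize (Real.sin t : ℂ) = S at *
  have hI : I ^ 2 = -1 := I_sq
  have hx3 : (C + S * I) ^ 3 = (C ^ 3 - 3 * C * S ^ 2) + (3 * C ^ 2 * S - S ^ 3) * I := by
    linear_combination (3 * C * S ^ 2 + S ^ 3 * I) * hI
  have hy3 : (C - S * I) ^ 3 = (C ^ 3 - 3 * C * S ^ 2) - (3 * C ^ 2 * S - S ^ 3) * I := by
    linear_combination (3 * C * S ^ 2 - S ^ 3 * I) * hI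
  rw [hx3, hy3]
  linear_combination (a * C + b * S * (1 - I ^ 2)) * z ^ 2 * hI + z ^ 4 * hI +
    z ^ 3 * ((c * C + d * S * (1 - I ^ 2) + e / 4 * (C - C ^ 3 + 3 * C * S ^ 2) +
      f / 4 * (3 * C ^ 2 * S - S ^ 3 + S) * (1 - I ^ 2)) * hI + (e / 4 * C + f / 4 * S) * hcs)
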